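/- arXiv:2306.04022 — 6 statements merged into one kernel-verified Lean document; each statement's English description precedes it below -/
import Mathlib

section
/- Let r ≥ 1 and s ∈ {-1, 1} be integers with Δ := r² + 4s > 0 and Δ not a perfect square, and let (U_n)_{n≥0} be the generalized Lucas sequence with U_0 = 0, U_1 = 1, U_{n+1} = r·U_n + s·U_{n-1}. For each fixed integer b ≥ 2, there are only finitely many quadruples (k, m, n, a) of positive integers with n > m, 1 ≤ a ≤ b − 1 and a·(b^k − 1)/(b − 1) = U_n − U_m. -/
theorem sum_range_card_le_sum_of_injOn_lt {ι : Type*} [Fintype ι] (w : ι → ℕ)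
    (hw : ∀ i j, w i = w j → w i < Fintype.card ι → i = j) :
    ∑ t ∈ Finset.range (Fintype.card ι), t ≤ ∑ i, w i := by
  classical
  set M := Fintype.card ι with hM
  set s : Finset ι := Finset.univ.filter fun i => w i < M with hs
  have hinj : Set.InjOn w (s : Set ι) := by
    intro i hi j _ hij
    exact hw i j hij (by simpa [hs] using hi)
  have himg : s.image w ⊆ Finset.range M := by
    intro t ht
    obtain ⟨i, hi, rfl⟩ := Finset.mem_image.1 ht
    simpa [hs] using hi
  have hcard : (s.image w).card = s.card := Finset.card_image_of_injOn hinj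
  have h1 : ∑ t ∈ Finset.range M \ s.image w, t ≤ ∑ i ∈ sᶜ, w i := by
    calc ∑ t ∈ Finset.range M \ s.image w, t
        ≤ (Finset.range M \ s.image w).card • M :=
          Finset.sum_le_card_nsmul _ _ _ fun t ht => by
            have := (Finset.mem_sdiff.1 ht).1
            exact (Finset.mem_range.1 this).le
      _ = sᶜ.card • M := by
          rw [Finset.card_sdiff_of_subset himg, hcard, Finset.card_compl, Finset.card_range]
      _ ≤ ∑ i ∈ sᶜ, w i := Finset.card_nsmul_le_sum _ _ _ fun i hi => by
          simpa [hs] using hi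
  have h2 : ∑ t ∈ s.image w, t = ∑ i ∈ s, w i := Finset.sum_image hinj
  rw [← Finset.sum_sdiff himg, h2, ← Finset.sum_add_sum_compl s w]
  omega

theorem abs_det_le_of_forall_row_le {ι : Type*} [Fintype ι] [DecidableEq ι] (A : Matrix ι ι ℝ)
    (B : ι → ℝ) (h : ∀ i j, |A i j| ≤ B i) :
    |A.det| ≤ (Fintype.card ι).factorial * ∏ i, B i := by
  rw [← Matrix.det_transpose, Matrix.det_apply]
  calc |∑ σ : Equiv.Perm ι, Equiv.Perm.sign σ • ∏ i, A.transpose (σ i) i|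
      ≤ ∑ σ : Equiv.Perm ι, |Equiv.Perm.sign σ • ∏ i, A.transpose (σ i) i| :=
        Finset.abs_sum_le_sum_abs _ _
    _ ≤ ∑ _σ : Equiv.Perm ι, ∏ i, B i := by
        refine Finset.sum_le_sum fun σ _ => ?_
        have : |Equiv.Perm.sign σ • ∏ i, A.transpose (σ i) i| = ∏ i, |A i (σ i)| := by
          rcases Int.units_eq_one_or (Equiv.Perm.sign σ) with h | h <;>
            simp [h, Finset.abs_prod]
        rw [this]
        exact Finset.prod_le_prod (fun _ _ => abs_nonneg _) fun i _ => h i _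
    _ = _ := by
        rw [Finset.sum_const, nsmul_eq_mul, Finset.card_univ, Fintype.card_perm]

open Polynomial in
/-- A Schwarz lemma for interpolation determinants: if every row of `W` is the evaluation of a
polynomial at the points `z j`, up to an error of relative size `E ^ (-M)`, then the determinant is
smaller than the trivial bound by a factor `E ^ (M (M - 1) / 2)`. -/
theorem abs_det_mul_pow_le {ι : Type*} [Fintype ι] [DecidableEq ι] (W : Matrix ι ι ℝ)
    (z : ι → ℝ) (p q : ι → ℝ[X]) (F : ι → ℝ) (E Z : ℝ) (hE : 1 ≤ E) (hz : ∀ j, |z j| ≤ Z)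
    (hpq : ∀ i m, |(p i).coeff m| ≤ (q i).coeff m) (hq : ∀ i, (q i).eval (E * Z) ≤ F i)
    (herr : ∀ i j, |W i j - (p i).eval (z j)| ≤ F i / E ^ Fintype.card ι) :
    |W.det| * E ^ (∑ t ∈ Finset.range (Fintype.card ι), t) ≤
      (Fintype.card ι).factorial * ∏ i, (2 * F i) := by
  classical
  rcases isEmpty_or_nonempty ι with hι | hι
  · simp
  have hZ : 0 ≤ Z := (abs_nonneg _).trans (hz (Classical.arbitrary ι))
  have hE0 : 0 < E := by linarith
  set M := Fintype.card ι with hM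
  obtain ⟨D, hD⟩ : ∃ D, ∀ i, (p i).natDegree < D ∧ (q i).natDegree < D := by
    refine ⟨(Finset.univ.sup fun i => max (p i).natDegree (q i).natDegree) + 1, fun i => ?_⟩
    have := Finset.le_sup (f := fun i => max (p i).natDegree (q i).natDegree) (Finset.mem_univ i)
    omega
  have hF : ∀ i, 0 ≤ F i := fun i => by
    have := (abs_nonneg _).trans (herr i (Classical.arbitrary ι))
    by_contra h
    push Not at h
    exact absurd this (not_le.2 (div_neg_of_neg_of_pos h (by positivity)))
  let c : ι → Option (Fin D) → ℝ := fun i o => o.elim 1 fun m => (p i).coeff m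
  let v : ι → Option (Fin D) → ι → ℝ := fun i o =>
    o.elim (fun j => W i j - (p i).eval (z j)) fun m j => z j ^ (m : ℕ)
  let B : ι → Option (Fin D) → ℝ := fun i o => o.elim (F i / E ^ M) fun m => Z ^ (m : ℕ)
  let wt : Option (Fin D) → ℕ := fun o => o.elim M fun m => m
  have hW : W = fun i => ∑ o, c i o • v i o := by
    ext i j
    simp only [Fintype.sum_option, c, v, Option.elim, Finset.sum_apply, Pi.smul_apply,
      smul_eq_mul, one_mul]
    rw [(p i).eval_eq_sum_range' (hD i).1, Finset.sum_range]
    ring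
  have hsum : W.det = ∑ r : ι → Option (Fin D),
      (∏ i, c i (r i)) * Matrix.det (fun i => v i (r i)) := by
    conv_lhs => rw [hW]
    have := (Matrix.detRowAlternating (R := ℝ) (n := ι)).toMultilinearMap.map_sum
      (fun i o => c i o • v i o)
    refine this.trans (Finset.sum_congr rfl fun r _ => ?_)
    exact MultilinearMap.map_smul_univ _ (fun i => c i (r i)) (fun i => v i (r i))
  have hterm : ∀ r : ι → Option (Fin D),
      |(∏ i, c i (r i)) * Matrix.det (fun i => v i (r i))| * E ^ (∑ t ∈ Finset.range M, t) ≤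
        M.factorial * ∏ i, (|c i (r i)| * B i (r i) * E ^ wt (r i)) := by
    intro r
    have hB : ∀ i o, 0 ≤ B i o := fun i o => by
      cases o
      · exact div_nonneg (hF i) (by positivity)
      · simp only [B, Option.elim]; positivity
    by_cases hr : ∀ i j, wt (r i) = wt (r j) → wt (r i) < M → i = j
    · have h1 := sum_range_card_le_sum_of_injOn_lt (fun i => wt (r i)) hr
      have h2 : |Matrix.det (fun i => v i (r i))| ≤ M.factorial * ∏ i, B i (r i) := by
        refine abs_det_le_of_forall_row_le _ _ fun i j => ?_
        cases h : r i with
        | none => simpa [v, B, h] using herr i j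
        | some m =>
          simp only [v, B, Option.elim, abs_pow]
          exact pow_le_pow_left₀ (abs_nonneg _) (hz j) _
      rw [abs_mul, Finset.abs_prod, Finset.prod_mul_distrib, Finset.prod_mul_distrib,
        Finset.prod_pow_eq_pow_sum]
      have h3 : E ^ (∑ t ∈ Finset.range M, t) ≤ E ^ (∑ i, wt (r i)) := pow_le_pow_right₀ hE h1
      have h4 : 0 ≤ ∏ i, |c i (r i)| := Finset.prod_nonneg fun _ _ => abs_nonneg _
      calc _ ≤ (∏ i, |c i (r i)|) * (M.factorial * ∏ i, B i (r i)) * E ^ (∑ i, wt (r i)) := by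
            have h5 : 0 ≤ ∏ i, B i (r i) := Finset.prod_nonneg fun i _ => hB i _
            gcongr
        _ = _ := by ring
    · push Not at hr
      obtain ⟨i, j, h1, h2, h3⟩ := hr
      have h0 : Matrix.det (fun i => v i (r i)) = 0 := by
        refine Matrix.det_zero_of_row_eq h3 ?_
        cases hi : r i with
        | none => simp [wt, hi] at h2
        | some m =>
          cases hj : r j with
          | none =>
            rw [hi] at h1 h2
            rw [hj] at h1
            rw [h1] at h2
            exact absurd h2 (lt_irrefl M)
          | some m' =>
            rw [hi, hj] at h1
            have h1 : (m : ℕ) = m' := h1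
            simp only [v, Option.elim, h1]
      rw [h0]
      simp only [mul_zero, abs_zero, zero_mul]
      exact mul_nonneg (by positivity) (Finset.prod_nonneg fun i _ =>
        mul_nonneg (mul_nonneg (abs_nonneg _) (hB _ _)) (by positivity))
  rw [hsum]
  calc _ ≤ (∑ r : ι → Option (Fin D), |(∏ i, c i (r i)) * Matrix.det (fun i => v i (r i))|) *
        E ^ (∑ t ∈ Finset.range M, t) := by
        gcongr
        exact Finset.abs_sum_le_sum_abs _ _
    _ ≤ ∑ r : ι → Option (Fin D), M.factorial * ∏ i, (|c i (r i)| * B i (r i) * E ^ wt (r i)) := by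
        rw [Finset.sum_mul]
        exact Finset.sum_le_sum fun r _ => hterm r
    _ = M.factorial * ∏ i, ∑ o, (|c i o| * B i o * E ^ wt o) := by
        rw [← Finset.mul_sum, Finset.prod_univ_sum, Fintype.piFinset_univ]
    _ ≤ _ := by
        have hc : ∀ i o, 0 ≤ |c i o| * B i o * E ^ wt o := fun i o => by
          have : 0 ≤ B i o := by
            cases o
            · exact div_nonneg (hF i) (by positivity)
            · simp only [B, Option.elim]; positivity
          positivity
        gcongr with i _
        · exact fun i _ => Finset.sum_nonneg fun o _ => hc i o
        rw [Fintype.sum_option, two_mul]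
        refine add_le_add ?_ ?_
        · simp only [c, B, wt, Option.elim, abs_one, one_mul]
          rw [div_mul_cancel₀ _ (by positivity)]
        · refine le_trans ?_ (hq i)
          rw [(q i).eval_eq_sum_range' (hD i).2, Finset.sum_range]
          refine Finset.sum_le_sum fun m _ => ?_
          simp only [c, B, wt, Option.elim]
          rw [mul_assoc, ← mul_pow, mul_comm Z E]
          gcongr
          exact hpq i m

theorem exists_det_submatrix_ne_zero {ι κ : Type*} [Fintype ι] [DecidableEq ι] [Fintype κ]
    (A : Matrix ι κ ℝ) (h : ∀ c : ι → ℝ, (∀ j, ∑ i, c i * A i j = 0) → c = 0) :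
    ∃ f : ι → κ, (A.submatrix id f).det ≠ 0 := by
  classical
  have hli : LinearIndependent ℝ A.row := by
    rw [Fintype.linearIndependent_iff]
    intro g hg i
    have := h g fun j => by
      have := congrFun hg j
      simpa [Finset.sum_apply] using this
    exact congrFun this i
  have hrank : A.rank = Fintype.card ι := hli.rank_matrix
  have hspan : Submodule.span ℝ (Set.range A.col) = ⊤ := by
    apply Submodule.eq_top_of_finrank_eq
    rw [← Matrix.rank_eq_finrank_span_cols, hrank, Module.finrank_fintype_fun_eq_card]
  obtain ⟨s, hs, hspan', hli'⟩ := exists_linearIndependent ℝ (Set.range A.col)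
  rw [hspan] at hspan'
  let b := Module.Basis.mk hli' (by rw [Subtype.range_coe]; exact hspan'.ge)
  have : Fintype s := FiniteDimensional.fintypeBasisIndex b
  let e : ι ≃ s := (Pi.basisFun ℝ ι).indexEquiv b
  choose f hf using fun i => hs (e i).2
  refine ⟨f, ?_⟩
  rw [← Matrix.det_transpose]
  have h2 : LinearIndependent ℝ (fun i => ((e i : s) : ι → ℝ)) := hli'.comp e e.injective
  have h3 : (A.submatrix id f).transpose.row = fun i => ((e i : s) : ι → ℝ) := by
    ext i j
    rw [← hf i]
    rfl
  have h4 := Matrix.linearIndependent_rows_iff_isUnit.1 (h3 ▸ h2)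
  exact ((Matrix.isUnit_iff_isUnit_det _).1 h4).ne_zero

open Polynomial in
theorem coeff_prod_sum_of_natDegree_le {ι : Type*} (s : Finset ι) (f : ι → ℝ[X]) (d : ι → ℕ)
    (h : ∀ i, (f i).natDegree ≤ d i) :
    (∏ i ∈ s, f i).coeff (∑ i ∈ s, d i) = ∏ i ∈ s, (f i).coeff (d i) := by
  classical
  induction s using Finset.induction_on with
  | empty => simp
  | insert a s ha ih =>
    rw [Finset.prod_insert ha, Finset.sum_insert ha, Finset.prod_insert ha, ← ih]
    exact coeff_mul_add_eq_of_natDegree_le (h a)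
      ((natDegree_prod_le _ _).trans (Finset.sum_le_sum fun i _ => h i))

open Polynomial in
theorem det_ne_zero_of_shift {I : Type*} [Fintype I] [DecidableEq I] (A : I → ℝ[X])
    (hA : ∀ i, A i ≠ 0) (e : I → ℕ) (he : Function.Injective e) (he' : ∀ i, e i < Fintype.card I)
    (x : I → ℝ) (hx : Function.Injective x) :
    (Matrix.of fun i l => (A l).comp (X + C (e i : ℝ)) * C (x l ^ e i)).det ≠ 0 := by
  intro h0
  have h1 := congrArg (fun p : ℝ[X] => p.coeff (∑ l, (A l).natDegree)) h0
  simp only [coeff_zero] at h1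
  have hcoeff : ∀ i l, ((A l).comp (X + C (e i : ℝ)) * C (x l ^ e i)).coeff (A l).natDegree =
      (A l).leadingCoeff * x l ^ e i := by
    intro i l
    rw [coeff_mul_C]
    congr 1
    have h2 : ((A l).comp (X + C (e i : ℝ))).natDegree = (A l).natDegree := by
      rw [natDegree_comp, natDegree_X_add_C, mul_one]
    rw [← h2, coeff_natDegree, leadingCoeff_comp (by rw [natDegree_X_add_C]; exact one_ne_zero),
      leadingCoeff_X_add_C, one_pow, mul_one]
  have hdeg : ∀ i l, ((A l).comp (X + C (e i : ℝ)) * C (x l ^ e i)).natDegree ≤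
      (A l).natDegree := by
    intro i l
    refine (natDegree_mul_C_le _ _).trans ?_
    rw [natDegree_comp, natDegree_X_add_C, mul_one]
  rw [Matrix.det_apply, finsetSum_coeff] at h1
  have h3 : (Matrix.of fun i l => (A l).leadingCoeff * x l ^ e i).det = 0 := by
    rw [Matrix.det_apply, ← h1]
    refine Finset.sum_congr rfl fun σ _ => ?_
    simp only [Matrix.of_apply]
    rw [coeff_smul, coeff_prod_sum_of_natDegree_le _ _ (fun l => (A l).natDegree)
      fun l => hdeg (σ l) l]
    simp only [hcoeff]
  have h4 : (Matrix.of fun i l => (A l).leadingCoeff * x l ^ e i) =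
      Matrix.of fun i l => (A l).leadingCoeff * (Matrix.of fun i l => x l ^ e i) i l := rfl
  rw [h4, Matrix.det_mul_row] at h3
  rcases mul_eq_zero.1 h3 with h5 | h5
  · obtain ⟨i, -, hi⟩ := Finset.prod_eq_zero_iff.1 h5
    exact hA i (leadingCoeff_eq_zero.1 hi)
  · let e' : I → Fin (Fintype.card I) := fun i => ⟨e i, he' i⟩
    have hbij : Function.Bijective e' := by
      rw [Fintype.bijective_iff_injective_and_card]
      exact ⟨fun i j hij => he (by simpa [e'] using hij), by simp⟩
    let E := Equiv.ofBijective e' hbij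
    have h6 : (Matrix.vandermonde fun l => x (E.symm l)).det ≠ 0 :=
      Matrix.det_vandermonde_ne_zero_iff.2 (hx.comp E.symm.injective)
    apply h6
    rw [← Matrix.det_transpose, ← Matrix.det_submatrix_equiv_self E, ← h5]
    congr 1
    ext i l
    simp [Matrix.vandermonde_apply, E, e']

open Polynomial in
/-- A zero estimate for polynomials in `X` and `Y` on the points `(u + N * v, c * x ^ u * y ^ v)`. -/
theorem eq_zero_of_forall_sum_eval_eq_zero {K L N R S : ℕ} (A : Fin L → ℝ[X])
    (hA : ∀ l, A l ≠ 0 → (A l).natDegree < K) (x y c : ℝ) (hx : 0 < x) (hx1 : x ≠ 1)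
    (hy : y ≠ 0) (hc : c ≠ 0) (hRN : R ≤ N) (hcard : L * K ≤ R * S)
    (h : ∀ u < R + L, ∀ v < S, ∑ l, (A l).eval ((u + N * v : ℕ) : ℝ) *
      (c * x ^ u * y ^ v) ^ (l : ℕ) = 0) (l : Fin L) : A l = 0 := by
  classical
  by_contra hl
  let I := {l : Fin L // A l ≠ 0}
  have hIL : Fintype.card I ≤ L := by
    simpa only [Fintype.card_fin] using Fintype.card_subtype_le fun l : Fin L => A l ≠ 0
  have hIpos : 0 < Fintype.card I := Fintype.card_pos_iff.2 ⟨⟨l, hl⟩⟩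
  let e : I → ℕ := fun i => (Fintype.equivFin I i : ℕ)
  have he : Function.Injective e := fun i j hij =>
    (Fintype.equivFin I).injective (Fin.ext hij)
  have he' : ∀ i, e i < Fintype.card I := fun i => (Fintype.equivFin I i).2
  have hxinj : Function.Injective fun i : I => x ^ ((i : Fin L) : ℕ) := fun i j hij =>
    Subtype.ext (Fin.ext (pow_right_injective₀ hx hx1 hij))
  set D : Matrix I I ℝ[X] := Matrix.of fun i l : I =>
    (A l).comp (X + C (e i : ℝ)) * C ((x ^ ((l : Fin L) : ℕ)) ^ e i) with hD
  have hne : D.det ≠ 0 := det_ne_zero_of_shift (fun i : I => A i) (fun i => i.2) e he he' _ hxinj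
  have hdeg : D.det.natDegree ≤ Fintype.card I * (K - 1) := by
    rw [Matrix.det_apply]
    refine natDegree_sum_le_of_forall_le _ _ fun σ _ => ?_
    refine (natDegree_smul_le _ _).trans ((natDegree_prod_le _ _).trans ?_)
    refine (Finset.sum_le_card_nsmul _ _ (K - 1) fun i _ => ?_).trans (by simp)
    refine (natDegree_mul_C_le _ _).trans ?_
    change ((A i).comp (X + C (e (σ i) : ℝ))).natDegree ≤ K - 1
    rw [natDegree_comp, natDegree_X_add_C, mul_one]
    exact Nat.le_sub_one_of_lt (hA _ i.2)
  apply hne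
  let pt : Fin R × Fin S → ℝ := fun a => ((a.1 + N * a.2 : ℕ) : ℝ)
  have hpt : Function.Injective pt := by
    rintro ⟨a, b⟩ ⟨a', b'⟩ hab
    have hab : (a : ℕ) + N * b = a' + N * b' := Nat.cast_injective (R := ℝ) hab
    have ha : (a : ℕ) < N := a.2.trans_le hRN
    have ha' : (a' : ℕ) < N := a'.2.trans_le hRN
    have h1 : (a : ℕ) = a' := by
      have := congrArg (· % N) hab
      simpa [Nat.add_mul_mod_self_left, Nat.mod_eq_of_lt ha, Nat.mod_eq_of_lt ha'] using this
    have h2 : (b : ℕ) = b' := by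
      rw [h1] at hab
      exact Nat.eq_of_mul_eq_mul_left (by omega) (Nat.add_left_cancel hab)
    exact Prod.ext (Fin.ext h1) (Fin.ext h2)
  refine eq_zero_of_natDegree_lt_card_of_eval_eq_zero D.det hpt ?_ ?_
  · rintro ⟨u, v⟩
    have hdet : eval (pt (u, v)) D.det = (D.map (eval (pt (u, v)))).det := by
      rw [← coe_evalRingHom, RingHom.map_det]
      rfl
    rw [hdet, ← Matrix.exists_mulVec_eq_zero_iff]
    refine ⟨fun l => (c * x ^ (u : ℕ) * y ^ (v : ℕ)) ^ ((l : Fin L) : ℕ), ?_, ?_⟩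
    · intro h0
      have := congrFun h0 ⟨l, hl⟩
      exact pow_ne_zero _ (by positivity) this
    · ext i
      have h1 := h (u + e i) (by have := he' i; omega) v v.2
      rw [← Finset.sum_filter_add_sum_filter_not _ (fun l => A l ≠ 0),
        Finset.sum_eq_zero (s := Finset.univ.filter fun l => ¬ A l ≠ 0)
          (fun l hl => by simp at hl; simp [hl]), add_zero,
        Finset.sum_subtype (p := fun l => A l ≠ 0) _ (by simp)] at h1
      rw [Pi.zero_apply, ← h1]
      rw [Matrix.mulVec, dotProduct]
      refine Finset.sum_congr rfl fun l _ => ?_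
      simp only [Matrix.map_apply, hD, Matrix.of_apply, eval_mul, eval_comp, eval_add, eval_X,
        eval_C, pt]
      push_cast
      rw [show (u : ℝ) + N * v + e i = u + e i + N * v by ring]
      ring
  · simp only [Fintype.card_prod, Fintype.card_fin]
    rcases Nat.eq_zero_or_pos K with hK | hK
    · exact absurd (hA l hl) (by omega)
    · calc D.det.natDegree ≤ Fintype.card I * (K - 1) := hdeg
        _ < Fintype.card I * K := Nat.mul_lt_mul_of_pos_left (by omega) hIpos
        _ ≤ L * K := Nat.mul_le_mul_right _ hIL
        _ ≤ R * S := hcard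

theorem eq_zero_of_forall_sum_mul_choose_eq_zero {K : ℕ} (c : Fin K → ℝ)
    (h : ∀ n : ℕ, ∑ k, c k * (n.choose k : ℝ) = 0) : c = 0 := by
  ext ⟨n, hn⟩
  induction n using Nat.strong_induction_on with
  | _ n ih =>
    have h1 := h n
    rw [Finset.sum_eq_single ⟨n, hn⟩] at h1
    · simpa using h1
    · rintro ⟨m, hm⟩ - hne
      have hne : m ≠ n := fun h => hne (Fin.ext h)
      rcases lt_or_gt_of_ne hne with hlt | hlt
      · rw [ih m hlt hm]; simp
      · simp [Nat.choose_eq_zero_of_lt hlt]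
    · simp

open Polynomial in
/-- The polynomial `q` bounds the polynomial `p` coefficientwise. -/
def Polynomial.IsMajorant (p q : ℝ[X]) : Prop := ∀ m, |p.coeff m| ≤ q.coeff m

open Polynomial in
theorem Polynomial.IsMajorant.mul {p q p' q' : ℝ[X]} (h : p.IsMajorant q) (h' : p'.IsMajorant q') :
    (p * p').IsMajorant (q * q') := by
  intro m
  rw [coeff_mul, coeff_mul]
  refine (Finset.abs_sum_le_sum_abs _ _).trans (Finset.sum_le_sum fun x _ => ?_)
  rw [abs_mul]
  exact mul_le_mul (h _) (h' _) (abs_nonneg _) ((abs_nonneg _).trans (h _))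

open Polynomial in
theorem isMajorant_descPochhammer {k K : ℕ} (h : k ≤ K) :
    (descPochhammer ℝ k).IsMajorant ((X + C (K : ℝ)) ^ k) := by
  induction k with
  | zero =>
    intro m
    simp only [descPochhammer_zero, pow_zero, coeff_one]
    split_ifs <;> simp
  | succ k ih =>
    rw [descPochhammer_succ_right, pow_succ]
    refine (ih (by omega)).mul fun m => ?_
    have hk : (k : ℝ) ≤ K := by exact_mod_cast (by omega : k ≤ K)
    rw [← C_eq_natCast, coeff_sub, coeff_add]
    simp only [coeff_X, coeff_C]
    rcases m with _ | _ | m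
    · simpa using hk
    · simp
    · simp

/-- The binomial coefficient `X` choose `k` as a real polynomial. -/
noncomputable def choosePoly (k : ℕ) : Polynomial ℝ :=
  Polynomial.C ((k.factorial : ℝ)⁻¹) * descPochhammer ℝ k

open Polynomial in
theorem choosePoly_eval_natCast (k n : ℕ) : (choosePoly k).eval (n : ℝ) = n.choose k := by
  rw [choosePoly, eval_mul, eval_C, descPochhammer_eval_eq_descFactorial,
    Nat.descFactorial_eq_factorial_mul_choose]
  push_cast
  rw [inv_mul_cancel_left₀ (by positivity)]

open Polynomial in
theorem choosePoly_natDegree_le (k : ℕ) : (choosePoly k).natDegree ≤ k :=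
  (natDegree_C_mul_le _ _).trans (descPochhammer_natDegree ℝ k).le

open Polynomial in
theorem isMajorant_choosePoly {k K : ℕ} (h : k ≤ K) :
    (choosePoly k).IsMajorant (C ((k.factorial : ℝ)⁻¹) * (X + C (K : ℝ)) ^ k) := by
  refine Polynomial.IsMajorant.mul (fun m => ?_) (isMajorant_descPochhammer h)
  rw [coeff_C]
  split_ifs
  · rw [abs_of_nonneg (by positivity)]
  · simp

open Polynomial in
theorem exists_polynomial_approx_choose_mul_exp {k K : ℕ} (h : k ≤ K) (θ ρ δ : ℝ) (hρ : 0 ≤ ρ)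
    (hδ : 0 < δ) (s : Finset ℕ) :
    ∃ p q : ℝ[X], p.IsMajorant q ∧
      q.eval ρ ≤ (ρ + K) ^ k / k.factorial * Real.exp (|θ| * ρ) ∧
      ∀ n ∈ s, |(n.choose k : ℝ) * Real.exp (θ * n) - p.eval (n : ℝ)| ≤ δ := by
  let T : ℝ → ℕ → ℝ[X] := fun θ D => ∑ m ∈ Finset.range D, monomial m (θ ^ m / m.factorial)
  have hTc : ∀ θ D m, (T θ D).coeff m = if m < D then θ ^ m / m.factorial else 0 := by
    intro θ D m
    simp [T, finsetSum_coeff, coeff_monomial]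
  have hTe : ∀ θ D x, (T θ D).eval x = ∑ m ∈ Finset.range D, (θ * x) ^ m / m.factorial := by
    intro θ D x
    simp only [T, eval_finsetSum, eval_monomial]
    exact Finset.sum_congr rfl fun m _ => by rw [mul_pow]; ring
  have hlim : ∀ x : ℝ, Filter.Tendsto (fun D => (T θ D).eval x) Filter.atTop
      (nhds (Real.exp (θ * x))) := by
    intro x
    simp only [hTe]
    rw [Real.exp_eq_exp_ℝ]
    exact (NormedSpace.expSeries_div_hasSum_exp (θ * x)).tendsto_sum_nat
  have hev : ∀ᶠ D in Filter.atTop, ∀ n ∈ s,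
      |(n.choose k : ℝ) * Real.exp (θ * n) - (choosePoly k * T θ D).eval (n : ℝ)| ≤ δ := by
    rw [Filter.eventually_all_finset]
    intro n _
    have h1 := ((hlim n).const_mul (n.choose k : ℝ)).const_sub ((n.choose k : ℝ) * Real.exp (θ * n))
    rw [sub_self] at h1
    have h2 := h1.abs
    rw [abs_zero] at h2
    filter_upwards [h2.eventually_le_const hδ] with D hD
    rwa [eval_mul, choosePoly_eval_natCast]
  obtain ⟨D, hD⟩ := hev.exists
  refine ⟨choosePoly k * T θ D, _, (isMajorant_choosePoly h).mul (q' := T |θ| D) ?_, ?_, hD⟩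
  · intro m
    rw [hTc, hTc]
    split_ifs
    · rw [abs_div, abs_pow, Nat.abs_cast]
    · simp
  · rw [eval_mul, hTe]
    simp only [eval_mul, eval_C, eval_pow, eval_add, eval_X]
    rw [← div_eq_inv_mul]
    gcongr
    exact Real.sum_le_exp_of_nonneg (by positivity) _

theorem eq_zero_of_forall_sum_choose_mul_pow_eq_zero {K L N R S : ℕ} (x y c₀ : ℝ) (hx : 0 < x)
    (hx1 : x ≠ 1) (hy : y ≠ 0) (hc₀ : c₀ ≠ 0) (hRN : R ≤ N) (hcard : L * K ≤ R * S)
    (c : Fin K × Fin L → ℝ)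
    (h : ∀ u < R + L, ∀ v < S, ∑ i, c i * (((u + N * v).choose i.1 : ℝ) *
      (c₀ * x ^ u * y ^ v) ^ (i.2 : ℕ)) = 0) : c = 0 := by
  let A : Fin L → Polynomial ℝ := fun l => ∑ k : Fin K, Polynomial.C (c (k, l)) * choosePoly k
  have hAe : ∀ l (n : ℕ), (A l).eval (n : ℝ) = ∑ k : Fin K, c (k, l) * (n.choose k : ℝ) := by
    intro l n
    simp [A, Polynomial.eval_finsetSum, choosePoly_eval_natCast]
  have hA : ∀ l, A l = 0 := by
    intro l
    refine eq_zero_of_forall_sum_eval_eq_zero A (fun l hl => ?_) x y c₀ hx hx1 hy hc₀ hRN hcard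
      (fun u hu v hv => ?_) l
    · rcases Nat.eq_zero_or_pos K with rfl | hK
      · exact absurd (by simp [A]) hl
      · refine lt_of_le_of_lt (Polynomial.natDegree_sum_le_of_forall_le (n := K - 1) _ _
          fun k _ => ?_) (by omega)
        exact (Polynomial.natDegree_C_mul_le _ _).trans
          ((choosePoly_natDegree_le _).trans (by omega))
    · rw [← h u hu v hv, Fintype.sum_prod_type_right]
      refine Finset.sum_congr rfl fun l _ => ?_
      rw [hAe, Finset.sum_mul]
      refine Finset.sum_congr rfl fun k _ => ?_
      ring
  ext ⟨k, l⟩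
  have := eq_zero_of_forall_sum_mul_choose_eq_zero (fun k => c (k, l)) (fun n => by
    rw [← hAe, hA l, Polynomial.eval_zero])
  exact congrFun this k

theorem pow_sum_range_le_of_interpolation {A : Type*} [CommRing A] (σ τ : A →+* ℝ)
    (hστ : ∀ x, σ x ≠ 0 → 1 ≤ |σ x| * |τ x|) {K L N R S : ℕ} (y : ℕ → ℕ → A)
    (c G η lam E F Z : ℝ) (hc : 0 < c) (hcG : c ≤ G) (hG : 1 ≤ G)
    (hσ : ∀ u < R + L, ∀ v < S, σ (y u v) = c * Real.exp (η * (u + N * v : ℕ) - lam * v))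
    (hτ : ∀ u < R + L, ∀ v < S, |τ (y u v)| ≤ G) (hη : η ≠ 0) (hRN : R ≤ N)
    (hcard : L * K ≤ R * S) (hE : 1 ≤ E) (hlam : 4 * L * S * |lam| * E ^ (K * L) ≤ 1)
    (hZ : ∀ u < R + L, ∀ v < S, ((u + N * v : ℕ) : ℝ) ≤ Z) (hZ0 : 0 ≤ Z) (hF1 : 1 ≤ F)
    (hF : ∀ k < K, (E * Z + K) ^ k / k.factorial * Real.exp (L * |η| * (E * Z)) ≤ F) :
    E ^ (∑ t ∈ Finset.range (K * L), t) ≤ ((K * L).factorial * (2 * F * G ^ L) ^ (K * L)) ^ 2 := by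
  classical
  have hcardι : Fintype.card (Fin K × Fin L) = K * L := by simp
  have hEM : (0 : ℝ) < E ^ (K * L) := by positivity
  have hEM1 : (1 : ℝ) ≤ E ^ (K * L) := one_le_pow₀ hE
  let P := Fin (R + L) × Fin S
  let z : P → ℕ := fun p => p.1 + N * p.2
  let D : Matrix (Fin K × Fin L) P A :=
    Matrix.of fun i p => ((z p).choose i.1 : A) * y p.1 p.2 ^ (i.2 : ℕ)
  have hσy : ∀ p : P, σ (y p.1 p.2) = c * Real.exp (η * z p - lam * (p.2 : ℕ)) :=
    fun p => hσ _ p.1.2 _ p.2.2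
  have hzZ : ∀ p : P, (z p : ℝ) ≤ Z := fun p => hZ _ p.1.2 _ p.2.2
  obtain ⟨f, hf⟩ := exists_det_submatrix_ne_zero (D.map σ) (by
    intro d hd
    refine eq_zero_of_forall_sum_choose_mul_pow_eq_zero (N := N) (Real.exp η)
      (Real.exp (N * η - lam)) c (Real.exp_pos _) (by simpa using hη) (Real.exp_pos _).ne'
      hc.ne' hRN hcard d fun u hu v hv => ?_
    rw [← hd (⟨u, hu⟩, ⟨v, hv⟩)]
    refine Finset.sum_congr rfl fun i _ => ?_
    simp only [D, z, Matrix.map_apply, Matrix.of_apply, map_mul, map_pow, map_natCast]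
    rw [hσ u hu v hv, ← Real.exp_nat_mul, ← Real.exp_nat_mul, mul_assoc c, ← Real.exp_add]
    congr 5
    push_cast
    ring)
  set T : Matrix (Fin K × Fin L) (Fin K × Fin L) A := D.submatrix id f with hT
  have hσT : σ T.det = ((D.map σ).submatrix id f).det := by
    rw [RingHom.map_det]; rfl
  have hchoose : ∀ (p : P) (k : Fin K), ((z p).choose k : ℝ) ≤
      (E * Z + K) ^ (k : ℕ) / (k : ℕ).factorial := by
    intro p k
    refine (Nat.choose_le_pow_div (k : ℕ) (z p)).trans ?_
    gcongr
    nlinarith [hzZ p, Nat.cast_nonneg (α := ℝ) K]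
  have hchF : ∀ (p : P) (k : Fin K), ((z p).choose k : ℝ) ≤ F := by
    intro p k
    refine le_trans ?_ (hF k k.2)
    exact (hchoose p k).trans (le_mul_of_one_le_right (by positivity)
      (Real.one_le_exp (by positivity)))
  have hτT : |τ T.det| ≤ (K * L).factorial * (F * G ^ L) ^ (K * L) := by
    rw [RingHom.map_det]
    refine (abs_det_le_of_forall_row_le _ (fun _ => F * G ^ L) fun i j => ?_).trans ?_
    · simp only [hT, D, RingHom.mapMatrix_apply, Matrix.map_apply, Matrix.submatrix_apply,
        Matrix.of_apply, map_mul, map_pow, map_natCast, id, abs_mul, abs_pow, Nat.abs_cast]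
      have h1 := hτ _ (f j).1.2 _ (f j).2.2
      gcongr
      · exact hchF _ _
      · exact (pow_le_pow_left₀ (abs_nonneg _) h1 _).trans (pow_le_pow_right₀ hG i.2.2.le)
    · simp
  let W : Matrix (Fin K × Fin L) (Fin K × Fin L) ℝ := Matrix.of fun i j =>
    ((z (f j)).choose i.1 : ℝ) * Real.exp (i.2 * (η * z (f j) - lam * ((f j).2 : ℕ)))
  have hσW : σ T.det = (∏ i : Fin K × Fin L, c ^ (i.2 : ℕ)) * W.det := by
    rw [hσT, ← Matrix.det_mul_column]
    congr 1
    ext i j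
    simp only [D, W, Matrix.map_apply, Matrix.submatrix_apply, Matrix.of_apply, map_mul, map_pow,
      map_natCast, id, hσy]
    rw [mul_pow, ← Real.exp_nat_mul]
    ring
  have happ : ∀ i : Fin K × Fin L, ∃ p q : Polynomial ℝ, p.IsMajorant q ∧ q.eval (E * Z) ≤ F ∧
      ∀ j, |W i j - p.eval (z (f j) : ℝ)| ≤ F / E ^ (K * L) := by
    intro i
    obtain ⟨p, q, hpq, hq, hp⟩ := exists_polynomial_approx_choose_mul_exp (k := i.1) (K := K)
      i.1.2.le (i.2 * η) (E * Z) (F / (2 * E ^ (K * L))) (by positivity) (by positivity)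
      (Finset.univ.image z)
    have hiL : ((i.2 : ℕ) : ℝ) ≤ L := by exact_mod_cast i.2.2.le
    refine ⟨p, q, hpq, hq.trans (le_trans ?_ (hF i.1 i.1.2)), fun j => ?_⟩
    · rw [abs_mul, Nat.abs_cast]
      gcongr
    · have h1 := hp (z (f j)) (by simp)
      have hjS : (((f j).2 : ℕ) : ℝ) ≤ S := by exact_mod_cast (f j).2.2.le
      set t : ℝ := -(i.2 * (lam * ((f j).2 : ℕ))) with ht
      have htabs : |t| ≤ L * (|lam| * S) := by
        rw [ht, abs_neg, abs_mul, abs_mul, Nat.abs_cast, Nat.abs_cast]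
        gcongr
      have h4 : 4 * (L * (|lam| * S)) ≤ 1 / E ^ (K * L) := by
        rw [le_div_iff₀ hEM]
        linarith
      have h5 : 1 / E ^ (K * L) ≤ 1 := by
        rw [div_le_one hEM]; exact hEM1
      have h6 : |Real.exp t - 1| ≤ 2 * |t| := Real.abs_exp_sub_one_le (by linarith)
      have h7 : |Real.exp t - 1| ≤ 1 / (2 * E ^ (K * L)) := by
        have : 1 / (2 * E ^ (K * L)) = 1 / E ^ (K * L) / 2 := by field_simp
        rw [this]; linarith
      have h8 : ((z (f j)).choose i.1 : ℝ) * Real.exp (i.2 * η * z (f j)) ≤ F := by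
        refine le_trans ?_ (hF i.1 i.1.2)
        refine mul_le_mul (hchoose _ _) (Real.exp_le_exp.2 ?_) (Real.exp_pos _).le (by positivity)
        have h9 : |(i.2 : ℝ) * η * z (f j)| ≤ L * |η| * (E * Z) := by
          rw [abs_mul, abs_mul, Nat.abs_cast, Nat.abs_cast]
          have := hzZ (f j)
          gcongr
          nlinarith
        exact (le_abs_self _).trans h9
      have h10 : W i j - p.eval (z (f j) : ℝ) =
          ((z (f j)).choose i.1 : ℝ) * Real.exp (i.2 * η * z (f j)) * (Real.exp t - 1) +
          (((z (f j)).choose i.1 : ℝ) * Real.exp (i.2 * η * z (f j)) -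
            p.eval (z (f j) : ℝ)) := by
        have : (i.2 : ℝ) * (η * z (f j) - lam * ((f j).2 : ℕ)) = i.2 * η * z (f j) + t := by
          rw [ht]; ring
        simp only [W, Matrix.of_apply, this, Real.exp_add]
        ring
      rw [h10]
      refine (abs_add_le _ _).trans ?_
      rw [abs_mul, abs_of_nonneg (by positivity :
        (0 : ℝ) ≤ ((z (f j)).choose i.1 : ℝ) * Real.exp (i.2 * η * z (f j)))]
      have h11 := mul_le_mul h8 h7 (abs_nonneg _) (by positivity)
      have h12 : F / E ^ (K * L) = F * (1 / (2 * E ^ (K * L))) + F / (2 * E ^ (K * L)) := by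
        field_simp; ring
      rw [h12]
      exact add_le_add h11 h1
  choose p q hpq hq hp using happ
  have hW := abs_det_mul_pow_le W (fun j => (z (f j) : ℝ)) p q (fun _ => F) E Z hE
    (fun j => by rw [Nat.abs_cast]; exact hzZ _) hpq hq (by rw [hcardι]; exact hp)
  rw [hcardι] at hW
  simp only [Finset.prod_const, Finset.card_univ, hcardι] at hW
  have hprod : (∏ i : Fin K × Fin L, c ^ (i.2 : ℕ)) ≤ (G ^ L) ^ (K * L) := by
    calc _ ≤ ∏ _i : Fin K × Fin L, G ^ L := by
          refine Finset.prod_le_prod (fun i _ => by positivity) fun i _ => ?_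
          exact (pow_le_pow_left₀ hc.le hcG _).trans (pow_le_pow_right₀ hG i.2.2.le)
      _ = _ := by simp
  have hone := hστ T.det (by rw [hσT]; exact hf)
  have hprod0 : 0 < ∏ i : Fin K × Fin L, c ^ (i.2 : ℕ) := by positivity
  calc E ^ (∑ t ∈ Finset.range (K * L), t)
      ≤ E ^ (∑ t ∈ Finset.range (K * L), t) * (|σ T.det| * |τ T.det|) :=
        le_mul_of_one_le_right (by positivity) hone
    _ = (∏ i : Fin K × Fin L, c ^ (i.2 : ℕ)) *
          (|W.det| * E ^ (∑ t ∈ Finset.range (K * L), t)) * |τ T.det| := by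
        rw [hσW, abs_mul, abs_of_pos hprod0]; ring
    _ ≤ (G ^ L) ^ (K * L) * ((K * L).factorial * (2 * F) ^ (K * L)) *
          ((K * L).factorial * (F * G ^ L) ^ (K * L)) := by
        gcongr
    _ = ((K * L).factorial : ℝ) ^ 2 * ((2 * F * G ^ L) ^ (K * L) * (F * G ^ L) ^ (K * L)) := by
        rw [mul_pow (2 * F)]; ring
    _ ≤ ((K * L).factorial : ℝ) ^ 2 *
          ((2 * F * G ^ L) ^ (K * L) * (2 * F * G ^ L) ^ (K * L)) := by
        gcongr
        linarith
    _ = _ := by ring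

theorem exists_interpolation_points {A : Type*} [CommRing A] (σ τ : A →+* ℝ) (w w' x y : A)
    (b : ℕ) (a l lx ly d : ℝ) (ha : 0 ≤ a) (hl : 0 ≤ l) (hσw : σ w = Real.exp a)
    (hσw' : σ w' = Real.exp (-a)) (hτw : |τ w| ≤ Real.exp a) (hτw' : |τ w'| ≤ Real.exp a)
    (hbl : (b : ℝ) = Real.exp l) (hσx : σ x = Real.exp lx) (hσy : σ y = Real.exp ly)
    (hτx : |τ x| ≤ Real.exp d) (hτy : |τ y| ≤ Real.exp d) (n₀ u v R S : ℕ) (k₀ : ℤ) :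
    ∃ f : ℕ → ℕ → A, ∀ i < R, ∀ j < S,
      σ (f i j) = Real.exp (l * (v * R + |(k₀ : ℝ)| * S) + lx * S) *
        Real.exp (i * (u * a - v * l) + j * (ly - lx + k₀ * l - n₀ * a)) ∧
      |τ (f i j)| ≤ Real.exp (a * (u * R + n₀ * S) + l * (v * R + 3 * |(k₀ : ℝ)| * S) + d * S) := by
  obtain ⟨m, hm⟩ : ∃ m : ℕ, (m : ℤ) = |k₀| + k₀ :=
    ⟨(|k₀| + k₀).toNat, Int.toNat_of_nonneg (by linarith [neg_abs_le k₀])⟩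
  have hm' : (m : ℝ) = |(k₀ : ℝ)| + k₀ := by exact_mod_cast hm
  have hκ : ((k₀.natAbs : ℕ) : ℝ) = |(k₀ : ℝ)| := by
    rw [Nat.cast_natAbs, Int.cast_abs]
  refine ⟨fun i j => w ^ (u * i) * w' ^ (n₀ * j) *
    (b : A) ^ (v * (R - i) + k₀.natAbs * (S - j) + m * j) * y ^ j * x ^ (S - j),
    fun i hi j hj => ⟨?_, ?_⟩⟩
  · simp only [map_mul, map_pow, map_natCast, hσw, hσw', hbl, hσx, hσy, ← Real.exp_nat_mul,
      ← Real.exp_add]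
    congr 1
    push_cast [Nat.cast_sub hi.le, Nat.cast_sub hj.le]
    rw [hm', hκ]
    ring
  · have hexp : ∀ (t c : ℝ) (e : ℕ), |t| ≤ Real.exp c → |t| ^ e ≤ Real.exp (e * c) := by
      intro t c e h
      rw [Real.exp_nat_mul]
      exact pow_le_pow_left₀ (abs_nonneg _) h e
    have hb' : |(b : ℝ)| ≤ Real.exp l := by rw [Nat.abs_cast, hbl]
    simp only [map_mul, map_pow, map_natCast, abs_mul, abs_pow]
    calc _ ≤ Real.exp ((u * i : ℕ) * a) * Real.exp ((n₀ * j : ℕ) * a) *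
          Real.exp ((v * (R - i) + k₀.natAbs * (S - j) + m * j : ℕ) * l) *
          Real.exp (j * d) * Real.exp ((S - j : ℕ) * d) := by
          gcongr <;> apply hexp <;> assumption
      _ ≤ _ := by
          simp only [← Real.exp_add]
          apply Real.exp_le_exp.2
          push_cast [Nat.cast_sub hi.le, Nat.cast_sub hj.le]
          rw [hm', hκ]
          have hi' : (i : ℝ) ≤ R := by exact_mod_cast hi.le
          have hj' : (j : ℝ) ≤ S := by exact_mod_cast hj.le
          have hk : (k₀ : ℝ) ≤ |(k₀ : ℝ)| := le_abs_self _
          have h1 : (u : ℝ) * i ≤ u * R := by gcongr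
          have h2 : (n₀ : ℝ) * j ≤ n₀ * S := by gcongr
          have h3 : (v : ℝ) * (R - i) + |(k₀ : ℝ)| * (S - j) + (|(k₀ : ℝ)| + k₀) * j ≤
              v * R + 3 * |(k₀ : ℝ)| * S := by
            have e1 : 0 ≤ (v : ℝ) * i := by positivity
            have e2 : (k₀ : ℝ) * j ≤ |(k₀ : ℝ)| * S := by gcongr
            have e3 : 0 ≤ |(k₀ : ℝ)| * S := by positivity
            nlinarith
          have h4 := mul_le_mul_of_nonneg_right (add_le_add h1 h2) ha
          have h5 := mul_le_mul_of_nonneg_right h3 hl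
          linarith

theorem log_le_of_pow_sum_range_le {K q : ℕ} (hK : 1 ≤ K) (hq : 1 ≤ q) (f g : ℝ)
    (h : (q : ℝ) ^ (∑ t ∈ Finset.range (K * 32), t) ≤ ((K * 32).factorial *
      (2 * Real.exp (K * f) * Real.exp (K * g) ^ 32) ^ (K * 32)) ^ 2) :
    4 * Real.log q ≤ 33 + f + 32 * g := by
  have hq' : (1 : ℝ) ≤ q := by exact_mod_cast hq
  have hK' : (1 : ℝ) ≤ K := by exact_mod_cast hK
  have hlq : 0 ≤ Real.log q := Real.log_nonneg hq'
  have h1 := Real.log_le_log (by positivity) h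
  rw [Real.log_pow, Real.log_pow, Real.log_mul (by positivity) (by positivity), Real.log_pow,
    Real.log_mul (by positivity) (by positivity), Real.log_mul (by positivity) (by positivity),
    Real.log_exp, Real.log_pow, Real.log_exp] at h1
  have h2 : Real.log ((K * 32).factorial : ℝ) ≤ (K * 32) * (K * 32) := by
    have : (((K * 32).factorial : ℕ) : ℝ) ≤ ((K * 32 : ℕ) : ℝ) ^ (K * 32) := by
      exact_mod_cast Nat.factorial_le_pow (K * 32)
    have h3 := Real.log_le_log (by positivity) this
    rw [Real.log_pow] at h3
    push_cast at h3
    have h4 := Real.log_le_self (x := (K : ℝ) * 32) (by positivity)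
    refine h3.trans ?_
    gcongr
  have h5 : ((∑ t ∈ Finset.range (K * 32), t : ℕ) : ℝ) * 2 = (K * 32) * (K * 32 - 1) := by
    have := Finset.sum_range_id_mul_two (K * 32)
    have h6 := congrArg (Nat.cast (R := ℝ)) this
    push_cast [Nat.cast_sub (show 1 ≤ K * 32 by omega)] at h6
    push_cast
    exact h6
  have hl2 : Real.log 2 ≤ 1 := by linarith [Real.log_two_lt_d9]
  have h7 : (K : ℝ) * (K * 32) * 8 * Real.log q ≤
      ((∑ t ∈ Finset.range (K * 32), t : ℕ) : ℝ) * Real.log q := by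
    refine mul_le_mul_of_nonneg_right ?_ hlq
    nlinarith
  push_cast at h1 h5 h7
  have h8 : ((K : ℝ) * (K * 32)) * (4 * Real.log q) ≤
      ((K : ℝ) * (K * 32)) * (33 + f + 32 * g) := by
    nlinarith
  exact le_of_mul_le_mul_left h8 (by positivity)

theorem height_le_of_parameters (a l lx ly lam η d q u v N n₀ n k₀ T S R : ℝ) (ha : 0 ≤ a)
    (hl : 0 ≤ l) (hlx : |lx| ≤ d) (hly : |ly| ≤ d) (hlam : |lam| ≤ 1) (hη_def : η = u * a - v * l)
    (hη : |η| ≤ l / q ^ 2) (hq : 1 ≤ q) (hqu : q ≤ u) (hN : 1 ≤ N) (hT : 0 ≤ T) (hR : 0 ≤ R)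
    (hn₀0 : 0 ≤ n₀) (hn₀ : n₀ ≤ u) (hn : n = N * u + n₀) (hqT : u ≤ q * T) (hS : S = q * T)
    (hqR : q * R ≤ 64 * N) (hNa : q * (4 * u * a + 3) ≤ N) (hd : 14 * q * u * d ≤ n)
    (hk₀ : k₀ * l = lx - ly + N * η + n₀ * a - lam) :
    a * (u * R + n₀ * S) + l * (v * R + 3 * |k₀| * S) + d * S ≤
      N * T * (64 * (2 * a + l) + 3 * l + 2) := by
  have hS0 : 0 ≤ S := by rw [hS]; positivity
  have hηl : |η| ≤ l / q := hη.trans (by gcongr; nlinarith)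
  have hηl1 : |η| ≤ l := hηl.trans (div_le_self hl (by linarith))
  have hvl : v * l ≤ u * (a + l) := by
    have := neg_abs_le η
    have : l ≤ u * l := le_mul_of_one_le_left hl (by linarith)
    linarith
  have hkl : |(k₀ : ℝ)| * l ≤ 2 * d + N * |η| + u * a + 1 := by
    have e2 : |(k₀ : ℝ)| * l = |(k₀ : ℝ) * l| := by rw [abs_mul, abs_of_nonneg hl]
    have e3 : n₀ * a ≤ u * a := by gcongr
    have e4 : |N * η| = N * |η| := by rw [abs_mul, abs_of_nonneg (by linarith)]
    have e5 : 0 ≤ n₀ * a := by positivity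
    rw [e2, hk₀, abs_le]
    have h1 := abs_le.1 hlx
    have h2 := abs_le.1 hly
    have h3 := abs_le.1 hlam
    have h4 := abs_le.1 e4.le
    constructor <;> linarith
  have hqd : q * (7 * d) ≤ N := by
    have h1 : (u : ℝ) * (q * (7 * d)) ≤ u * N := by
      have : (u : ℝ) ≤ N * u := le_mul_of_one_le_left (by linarith) hN
      linarith
    exact le_of_mul_le_mul_left h1 (by linarith)
  have hqη : q * (3 * (N * |η|)) ≤ N * (3 * l) := by
    have h1 : q * |η| ≤ l := by
      rw [le_div_iff₀ (by linarith)] at hηl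
      linarith
    have : N * (3 * (q * |η|)) ≤ N * (3 * l) := by gcongr
    linarith
  have h1 : a * (u * R) + l * (v * R) ≤
      N * T * (64 * (2 * a + l)) := by
      calc a * (u * R) + l * (v * R)
        = R * (u * a + v * l) := by ring
      _ ≤ R * (u * (2 * a + l)) := by gcongr; linarith
      _ ≤ R * ((q * T) * (2 * a + l)) := by gcongr
      _ = (q * R) * (T * (2 * a + l)) := by ring
      _ ≤ (64 * N) * (T * (2 * a + l)) := by gcongr
      _ = N * T * (64 * (2 * a + l)) := by ring
  have h2 : a * (n₀ * S) + l * (3 * |(k₀ : ℝ)| * S) + d * S ≤ N * T * (3 * l + 2) := by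
    calc a * (n₀ * S) + l * (3 * |(k₀ : ℝ)| * S) + d * S
        = (n₀ * a + 3 * (|(k₀ : ℝ)| * l) + d) * S := by ring
      _ ≤ (u * a + 3 * (2 * d + N * |η| + u * a + 1) + d) * S := by gcongr
      _ = (q * (7 * d) + q * (3 * (N * |η|)) + q * (4 * u * a + 3)) * T := by rw [hS]; ring
      _ ≤ (N + N * (3 * l) + N) * T := by gcongr
      _ = N * T * (3 * l + 2) := by ring
  linarith

theorem pow_div_factorial_mul_exp_le {i K q : ℕ} (hi : i < K) (hq : 1 ≤ q) (η l : ℝ)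
    (hη : |η| ≤ l / q ^ 2) :
    ((q : ℝ) * (q * K) + K) ^ i / i.factorial * Real.exp (32 * |η| * (q * (q * K))) ≤
      Real.exp (K * (2 * Real.log q + 2 + 32 * l)) := by
  have hq' : (1 : ℝ) ≤ q := by exact_mod_cast hq
  have hK1' : (1 : ℝ) ≤ K := by exact_mod_cast Nat.one_le_of_lt hi
  have h1 : (q : ℝ) * (q * K) + K ≤ q ^ 2 * 2 * K := by
    have : (K : ℝ) * 1 ≤ K * q ^ 2 := by gcongr; nlinarith [hq]
    linarith
  have h2 : (((q : ℝ) * (q * K) + K) ^ i / i.factorial) ≤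
      Real.exp (K * (2 * Real.log q + 1)) * Real.exp K := by
    calc (((q : ℝ) * (q * K) + K) ^ i / i.factorial)
        ≤ (q ^ 2 * 2 * K) ^ i / i.factorial := by gcongr
      _ = (q ^ 2 * 2) ^ i * (K ^ i / i.factorial) := by rw [mul_pow]; ring
      _ ≤ (q ^ 2 * 2) ^ K * Real.exp K := by
          gcongr
          · nlinarith
          · exact Real.pow_div_factorial_le_exp _ (by positivity) _
      _ ≤ Real.exp (2 * Real.log q + 1) ^ K * Real.exp K := by
          gcongr
          rw [Real.exp_add]
          have e1 : (q : ℝ) ^ 2 = Real.exp (2 * Real.log q) := by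
            rw [two_mul, Real.exp_add, Real.exp_log (by linarith)]; ring
          rw [e1]
          gcongr
          linarith [Real.add_one_le_exp (1 : ℝ)]
      _ = _ := by rw [← Real.exp_nat_mul]
  have h3 : 32 * |η| * (q * (q * K)) ≤ K * (32 * l) := by
    rw [le_div_iff₀ (by positivity)] at hη
    calc 32 * |η| * (q * (q * K)) = (|η| * q ^ 2) * (K * 32) := by ring
      _ ≤ l * (K * 32) := by gcongr
      _ = K * (32 * l) := by ring
  calc _ ≤ Real.exp (K * (2 * Real.log q + 1)) * Real.exp K * Real.exp (K * (32 * l)) := by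
        gcongr
    _ = _ := by
        rw [← Real.exp_add, ← Real.exp_add]
        congr 1; ring

set_option maxHeartbeats 400000 in
theorem exp_neg_le_abs_linear_form {A : Type*} [CommRing A] (σ τ : A →+* ℝ)
    (hστ : ∀ x, σ x ≠ 0 → 1 ≤ |σ x| * |τ x|) (w w' x y : A)
    (b : ℕ) (a l lx ly d ε : ℝ) (ha : 0 ≤ a) (hl : 0 ≤ l) (hσw : σ w = Real.exp a)
    (hσw' : σ w' = Real.exp (-a)) (hτw : |τ w| ≤ Real.exp a) (hτw' : |τ w'| ≤ Real.exp a)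
    (hbl : (b : ℝ) = Real.exp l) (hσx : σ x = Real.exp lx) (hσy : σ y = Real.exp ly)
    (hτx : |τ x| ≤ Real.exp d) (hτy : |τ y| ≤ Real.exp d) (hlx : |lx| ≤ d) (hly : |ly| ≤ d)
    (q u v n N n₀ k : ℕ) (hq : 64 ≤ q) (hqu : q ≤ u) (hη₀ : u * a - v * l ≠ 0)
    (hη : |u * a - v * l| ≤ l / q ^ 2)
    (hqlog : 35 + 32 * l + 32 * (64 * (2 * a + l) + 3 * l + 2) < 2 * Real.log q)
    (hε : 0 < ε) (hqε : 128 * Real.log q ≤ ε * q) (hn : n = N * u + n₀) (hn₀ : n₀ < u)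
    (hNa : q * (4 * u * a + 3) ≤ N) (hN : 2 * q ≤ N)
    (hnε : Real.log (128 * (q * (u / q + 1) : ℕ)) ≤ ε * n / 2)
    (hd : 14 * q * u * d ≤ n) :
    Real.exp (-(ε * n)) ≤ |lx + n * a - ly - k * l| := by
  by_contra! hlam
  set lam : ℝ := lx + n * a - ly - k * l with hlam_def
  set η : ℝ := u * a - v * l with hη_def
  obtain ⟨k₀, hk₀⟩ : ∃ k₀ : ℤ, (k : ℤ) = N * v + k₀ := ⟨k - N * v, by ring⟩
  have hk₀' : (k : ℝ) = N * v + k₀ := by exact_mod_cast hk₀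
  have hn' : (n : ℝ) = N * u + n₀ := by exact_mod_cast hn
  set T : ℕ := u / q + 1 with hT
  set S : ℕ := q * T with hS
  set K : ℕ := N * T with hK
  set R : ℕ := 32 * N / q + 1 with hR
  have hqpos : 0 < q := by omega
  have hd0 : 0 ≤ d := (abs_nonneg _).trans hlx
  have hq' : (64 : ℝ) ≤ q := by exact_mod_cast hq
  have hqu' : (q : ℝ) ≤ u := by exact_mod_cast hqu
  have hN' : 2 * (q : ℝ) ≤ N := by exact_mod_cast hN
  have hn₀' : (n₀ : ℝ) ≤ u := by exact_mod_cast hn₀.le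
  have hT1 : 1 ≤ T := Nat.le_add_left 1 _
  have hT1' : (1 : ℝ) ≤ T := by exact_mod_cast hT1
  have hN1 : 1 ≤ N := by omega
  have hK1 : 1 ≤ K := Nat.one_le_iff_ne_zero.2 (by positivity)
  have hqT : u ≤ q * T := (Nat.lt_mul_div_succ u hqpos).le
  have hqT' : (u : ℝ) ≤ q * T := by exact_mod_cast hqT
  have hTq : q * T ≤ 2 * u := by
    have := Nat.mul_div_le u q
    rw [hT, mul_add]; omega
  have hTq' : (q : ℝ) * T ≤ 2 * u := by exact_mod_cast hTq
  have hRq : 32 * N ≤ R * q := by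
    rw [mul_comm R]; exact (Nat.lt_mul_div_succ _ hqpos).le
  have hqR : q * (R + 32) ≤ 64 * N := by
    have := Nat.mul_div_le (32 * N) q
    have e : q * (R + 32) = q * (32 * N / q) + 33 * q := by rw [hR]; ring
    omega
  have hqR' : (q : ℝ) * (R + 32) ≤ 64 * N := by exact_mod_cast hqR
  have hRN : R + 32 ≤ N := by
    have : 64 * (R + 32) ≤ 64 * N := (Nat.mul_le_mul_right _ hq).trans hqR
    omega
  have hcard : 32 * K ≤ R * S := by
    rw [hS, hK, ← mul_assoc, ← mul_assoc]; exact Nat.mul_le_mul_right T hRq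
  have hS' : (S : ℝ) = q * T := by rw [hS]; push_cast; ring
  have hK' : (K : ℝ) = N * T := by rw [hK]; push_cast; ring
  have hlogq : 0 ≤ Real.log q := Real.log_nonneg (by linarith)
  have hlam1 : |lam| ≤ 1 := by
    refine hlam.le.trans (Real.exp_le_one_iff.2 ?_)
    have : 0 ≤ ε * n := by positivity
    linarith
  set g : ℝ := 64 * (2 * a + l) + 3 * l + 2 with hg
  set H : ℝ := a * (u * ((R + 32 : ℕ) : ℝ) + n₀ * S) +
    l * (v * ((R + 32 : ℕ) : ℝ) + 3 * |(k₀ : ℝ)| * S) + d * S with hH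
  have hHg : H ≤ K * g := by
    rw [hK']
    refine height_le_of_parameters a l lx ly lam η d q u v N n₀ n k₀ T S _ ha hl hlx hly hlam1
      hη_def hη (by linarith) hqu' (by exact_mod_cast hN1) (by positivity) (by positivity)
      (by positivity) hn₀' hn' hqT' hS' (by push_cast; exact hqR') hNa hd ?_
    have : (k₀ : ℝ) = k - N * v := by linarith
    rw [this, hlam_def, hη_def, hn']; ring
  have hg0 : 0 ≤ g := by positivity
  obtain ⟨f, hf⟩ := exists_interpolation_points σ τ w w' x y b a l lx ly d ha hl hσw hσw' hτw
    hτw' hbl hσx hσy hτx hτy n₀ u v (R + 32) S k₀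
  have hlamη : ly - lx + k₀ * l - n₀ * a = N * η - lam := by
    rw [hlam_def, hη_def, hn', hk₀']; ring
  set φ : ℝ := 2 * Real.log q + 2 + 32 * l with hφ
  have hmain := pow_sum_range_le_of_interpolation σ τ hστ (K := K) (L := 32) (N := N) (R := R)
    (S := S) f (Real.exp (l * (v * ((R + 32 : ℕ) : ℝ) + |(k₀ : ℝ)| * S) + lx * S))
    (Real.exp (K * g)) η lam q (Real.exp (K * φ)) (q * K) (Real.exp_pos _)
    (Real.exp_le_exp.2 (le_trans ?_ hHg)) (Real.one_le_exp (by positivity))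
    (fun i hi j hj => ?_)
    (fun i hi j hj => ((hf i hi j hj).2).trans (Real.exp_le_exp.2 hHg)) hη₀
    (by omega) hcard (by linarith) ?_ (fun i hi j hj => ?_) (by positivity)
    (Real.one_le_exp (by positivity)) (fun i hi => ?_)
  · have := log_le_of_pow_sum_range_le hK1 hqpos φ g hmain
    linarith
  · rw [hH]
    have h1 : lx * S ≤ d * S := by
      have := le_abs_self lx
      gcongr
      linarith
    have h2 : 0 ≤ a * (u * ((R + 32 : ℕ) : ℝ) + n₀ * S) := by positivity
    have h3 : 0 ≤ l * (2 * |(k₀ : ℝ)| * S) := by positivity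
    linarith
  · rw [(hf i hi j hj).1, hlamη]
    congr 2
    push_cast
    ring
  · have h1 : (S : ℝ) * 128 = Real.exp (Real.log (128 * S)) := by
      rw [Real.exp_log (by rw [hS']; positivity)]; ring
    have h2 : (q : ℝ) ^ (K * 32) = Real.exp (K * 32 * Real.log q) := by
      rw [← Real.exp_log (show (0 : ℝ) < q by linarith), ← Real.exp_nat_mul, Real.log_exp]
      push_cast; ring_nf
    have h3 : K * 32 * Real.log q ≤ ε * n / 2 := by
      have e1 : (q : ℝ) * (K * 32 * Real.log q) ≤ q * (ε * n / 2) := by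
        calc (q : ℝ) * (K * 32 * Real.log q) = N * (q * T) * (32 * Real.log q) := by
              rw [hK']; ring
          _ ≤ N * (2 * u) * (32 * Real.log q) := by gcongr
          _ = N * u * (128 * Real.log q) / 2 := by ring
          _ ≤ N * u * (ε * q) / 2 := by gcongr
          _ ≤ n * (ε * q) / 2 := by
              have : (N : ℝ) * u ≤ n := by rw [hn']; linarith [Nat.cast_nonneg (α := ℝ) n₀]
              gcongr
          _ = _ := by ring
      exact le_of_mul_le_mul_left e1 (by linarith)
    push_cast
    calc 4 * 32 * (S : ℝ) * |lam| * (q : ℝ) ^ (K * 32)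
        = (S * 128) * |lam| * (q : ℝ) ^ (K * 32) := by ring
      _ ≤ Real.exp (ε * n / 2) * Real.exp (-(ε * n)) * Real.exp (ε * n / 2) := by
          rw [h1, h2]
          gcongr
      _ = 1 := by
          rw [← Real.exp_add, ← Real.exp_add, Real.exp_eq_one_iff]; ring
  · have h1 : i + N * j ≤ N * S := by
      have : N * (j + 1) ≤ N * S := Nat.mul_le_mul_left _ hj
      rw [mul_add] at this; omega
    have h2 : ((N * S : ℕ) : ℝ) = q * K := by push_cast; rw [hS', hK']; ring
    rw [← h2]
    exact_mod_cast h1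
  · rw [hφ]
    push_cast
    exact pow_div_factorial_mul_exp_le hi hqpos η l hη

theorem exists_nat_abs_mul_sub_mul_le {a l : ℝ} (ha : 0 < a) (hl : 0 < l)
    (hirr : Irrational (a / l)) {q : ℕ} (hq : 1 ≤ q) :
    ∃ u v : ℕ, q ≤ u ∧ u * a - v * l ≠ 0 ∧ |u * a - v * l| ≤ l / q ^ 2 := by
  obtain ⟨j, k, hk, -, hjk⟩ := Real.exists_int_int_abs_mul_sub_le (a / l) (n := q ^ 3)
    (by positivity)
  have hq' : (1 : ℝ) ≤ q := by exact_mod_cast hq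
  have hk' : (1 : ℝ) ≤ k := by exact_mod_cast hk
  have hle : |(k : ℝ) * (a / l) - j| ≤ 1 / (q : ℝ) ^ 3 := by
    refine hjk.trans ?_
    push_cast
    gcongr
    linarith
  have hj : 0 ≤ j := by
    have h1 : 1 / (q : ℝ) ^ 3 ≤ 1 := by
      rw [div_le_one (by positivity)]
      exact one_le_pow₀ hq'
    have h2 : 0 < (k : ℝ) * (a / l) := by positivity
    have h3 := (abs_le.1 hle).2
    have h4 : (-1 : ℝ) < j := by linarith
    have h5 : -1 < j := by exact_mod_cast h4
    omega
  lift k to ℕ using hk.le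
  lift j to ℕ using hj
  have hk0 : 0 < k := by exact_mod_cast hk
  refine ⟨q * k, q * j, Nat.le_mul_of_pos_right q hk0, ?_, ?_⟩
  · intro h0
    refine hirr.ne_rat ((j : ℚ) / k) ?_
    have hk0' : (k : ℝ) ≠ 0 := by positivity
    have h1 : (q : ℝ) * (k * a - j * l) = 0 := by
      rw [← h0]; push_cast; ring
    have h2 := (mul_eq_zero.1 h1).resolve_left (by positivity)
    push_cast
    rw [div_eq_div_iff hl.ne' hk0']
    linarith
  · have h1 : ((q * k : ℕ) : ℝ) * a - ((q * j : ℕ) : ℝ) * l =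
        q * l * ((k : ℝ) * (a / l) - j) := by
      push_cast
      field_simp
    rw [h1, abs_mul, abs_of_nonneg (by positivity)]
    calc q * l * |(k : ℝ) * (a / l) - j| ≤ q * l * (1 / (q : ℝ) ^ 3) := by
          gcongr
          exact_mod_cast hle
      _ = l / q ^ 2 := by field_simp

theorem exists_forall_exp_neg_le_abs_linear_form {A : Type*} [CommRing A] (σ τ : A →+* ℝ)
    (hστ : ∀ x, σ x ≠ 0 → 1 ≤ |σ x| * |τ x|) (w w' : A) (b : ℕ) {a l : ℝ} (ha : 0 < a)
    (hl : 0 < l) (hirr : Irrational (a / l)) (hσw : σ w = Real.exp a)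
    (hσw' : σ w' = Real.exp (-a)) (hτw : |τ w| ≤ Real.exp a) (hτw' : |τ w'| ≤ Real.exp a)
    (hbl : (b : ℝ) = Real.exp l) {ε : ℝ} (hε : 0 < ε) :
    ∃ δ : ℝ, 0 < δ ∧ ∃ n₁ : ℕ, ∀ n ≥ n₁, ∀ (k : ℕ) (x y : A) (lx ly : ℝ),
      σ x = Real.exp lx → σ y = Real.exp ly → |τ x| ≤ Real.exp (δ * n) →
      |τ y| ≤ Real.exp (δ * n) → lx ≤ δ * n → ly ≤ δ * n →
      Real.exp (-(ε * n)) ≤ |lx + n * a - ly - k * l| := by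
  have hlog : Filter.Tendsto (fun q : ℕ => 2 * Real.log q) Filter.atTop Filter.atTop :=
    (Real.tendsto_log_atTop.comp tendsto_natCast_atTop_atTop).const_mul_atTop two_pos
  have hlit := (Real.isLittleO_log_id_atTop.comp_tendsto
    (tendsto_natCast_atTop_atTop (R := ℝ))).bound (show 0 < ε / 128 by positivity)
  obtain ⟨q, hq, hqlog, hqε⟩ := ((Filter.eventually_ge_atTop 64).and
    ((hlog.eventually_gt_atTop
      (35 + 32 * l + 32 * (64 * (2 * a + l) + 3 * l + 2))).and hlit)).exists
  have hqε' : 128 * Real.log q ≤ ε * q := by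
    simp only [Function.comp, id, Real.norm_eq_abs, Nat.abs_cast] at hqε
    have := le_abs_self (Real.log q)
    linarith
  obtain ⟨u, v, hqu, hη₀, hη⟩ := exists_nat_abs_mul_sub_mul_le ha hl hirr (q := q) (by omega)
  have hu0 : 0 < u := by omega
  have hq0 : (0 : ℝ) < q := by exact_mod_cast (by omega : 0 < q)
  have hu0' : (0 : ℝ) < u := by exact_mod_cast hu0
  set N₁ : ℕ := 2 * q + ⌈q * (4 * u * a + 3)⌉₊ with hN₁
  set c : ℝ := Real.log (128 * (q * (u / q + 1) : ℕ)) with hc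
  refine ⟨1 / (14 * q * u), by positivity, N₁ * u + ⌈2 * c / ε⌉₊,
    fun n hn k x y lx ly hσx hσy hτx hτy hlx hly => ?_⟩
  have hlb : ∀ (z : A) (lz : ℝ), σ z = Real.exp lz →
      |τ z| ≤ Real.exp (1 / (14 * q * u) * n) → lz ≤ 1 / (14 * q * u) * n →
      |lz| ≤ 1 / (14 * q * u) * n := by
    intro z lz hz hτz hlz
    have h1 := hστ z (by rw [hz]; exact (Real.exp_pos _).ne')
    rw [hz, Real.abs_exp] at h1
    have h2 : (1 : ℝ) ≤ Real.exp (lz + 1 / (14 * q * u) * n) := by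
      rw [Real.exp_add]
      exact h1.trans (by gcongr)
    rw [Real.one_le_exp_iff] at h2
    exact abs_le.2 ⟨by linarith, hlz⟩
  have hN : N₁ ≤ n / u := (Nat.le_div_iff_mul_le hu0).2 (by omega)
  have hN' : ((N₁ : ℕ) : ℝ) ≤ (n / u : ℕ) := by exact_mod_cast hN
  refine exp_neg_le_abs_linear_form σ τ hστ w w' x y b a l lx ly _ ε ha.le hl.le hσw hσw' hτw hτw'
    hbl hσx hσy hτx hτy (hlb x lx hσx hτx hlx) (hlb y ly hσy hτy hly) q u v n (n / u) (n % u) k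
    hq hqu hη₀ hη hqlog hε hqε' (Nat.div_add_mod' n u).symm (Nat.mod_lt n hu0) ?_ (by omega) ?_ ?_
  · refine (Nat.le_ceil _).trans (le_trans ?_ hN')
    rw [hN₁]
    push_cast
    linarith
  · have h1 : 2 * c / ε ≤ n := by
      refine (Nat.le_ceil _).trans ?_
      exact_mod_cast (by omega : ⌈2 * c / ε⌉₊ ≤ n)
    rw [div_le_iff₀ hε] at h1
    linarith
  · rw [show 14 * (q : ℝ) * u * (1 / (14 * q * u) * n) = n by field_simp]

theorem abs_log_sub_log_le {X Y t : ℝ} (hX : 0 < X) (hY : 0 < Y) (ht : t ≤ 1 / 2)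
    (h : |X - Y| ≤ t * X) : |Real.log X - Real.log Y| ≤ 2 * t := by
  have h1 := abs_le.1 h
  rw [← Real.log_div hX.ne' hY.ne', abs_le]
  constructor
  · have h2 := Real.one_sub_inv_le_log_of_pos (div_pos hX hY)
    rw [inv_div] at h2
    have h3 : Y / X ≤ 1 + t := by
      rw [div_le_iff₀ hX]; linarith
    have h4 : 0 ≤ t := by
      by_contra! h0
      have := mul_neg_of_neg_of_pos h0 hX
      linarith [abs_nonneg (X - Y)]
    linarith
  · have h2 := Real.log_le_sub_one_of_pos (div_pos hX hY)
    have h4 : 0 ≤ t := by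
      by_contra! h0
      have := mul_neg_of_neg_of_pos h0 hX
      linarith [abs_nonneg (X - Y)]
    have h3 : X / Y ≤ 1 + 2 * t := by
      rw [div_le_iff₀ hY]
      have h5 : X / 2 ≤ Y := by nlinarith
      nlinarith
    linarith

theorem exists_forall_exp_neg_le_of_abs_sub_le {A : Type*} [CommRing A] (σ τ : A →+* ℝ)
    (hστ : ∀ x, σ x ≠ 0 → 1 ≤ |σ x| * |τ x|) (w w' : A) (hw : w * w' = 1) {b : ℕ} (hb : 2 ≤ b)
    (hσw : 1 < σ w) (hτw : |τ w| ≤ σ w) (hτw' : |τ w'| ≤ σ w)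
    (hirr : Irrational (Real.log (σ w) / Real.log b)) {ε : ℝ} (hε : 0 < ε) :
    ∃ δ : ℝ, 0 < δ ∧ ∃ n₁ : ℕ, ∀ n ≥ n₁, ∀ (k : ℕ) (x y : A), 0 < σ x → 0 < σ y →
      σ x ≤ Real.exp (δ * n) → σ y ≤ Real.exp (δ * n) → |τ x| ≤ Real.exp (δ * n) →
      |τ y| ≤ Real.exp (δ * n) → ∀ t ≤ (1 / 2 : ℝ),
      |σ x * σ w ^ n - σ y * b ^ k| ≤ t * (σ x * σ w ^ n) → Real.exp (-(ε * n)) ≤ 2 * t := by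
  have hw0 : 0 < σ w := by linarith
  have hb0 : (0 : ℝ) < b := by positivity
  have hexp : Real.exp (Real.log (σ w)) = σ w := Real.exp_log hw0
  have hσw' : σ w' = Real.exp (-Real.log (σ w)) := by
    rw [Real.exp_neg, hexp]
    refine eq_inv_of_mul_eq_one_right ?_
    rw [← map_mul, hw, map_one]
  obtain ⟨δ, hδ, n₁, h⟩ := exists_forall_exp_neg_le_abs_linear_form σ τ hστ w w' b
    (Real.log_pos hσw) (Real.log_pos (by exact_mod_cast hb : (1 : ℝ) < b)) hirr hexp.symm hσw'
    (by rwa [hexp]) (by rwa [hexp]) (Real.exp_log hb0).symm hε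
  refine ⟨δ, hδ, n₁, fun n hn k x y hx hy hxδ hyδ hτx hτy t ht hxy => ?_⟩
  have h1 := h n hn k x y _ _ (Real.exp_log hx).symm (Real.exp_log hy).symm hτx hτy
    ((Real.log_le_iff_le_exp hx).2 hxδ) ((Real.log_le_iff_le_exp hy).2 hyδ)
  refine h1.trans ?_
  have h2 := abs_log_sub_log_le (by positivity) (by positivity) ht hxy
  rw [Real.log_mul hx.ne' (by positivity), Real.log_mul hy.ne' (by positivity), Real.log_pow,
    Real.log_pow] at h2
  rwa [← sub_sub] at h2

theorem eventually_le_exp_mul {c : ℝ} (hc : 0 < c) (y : ℝ) :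
    ∀ᶠ n : ℕ in Filter.atTop, y ≤ Real.exp (c * n) :=
  (Real.tendsto_exp_atTop.comp
    (tendsto_natCast_atTop_atTop.const_mul_atTop hc)).eventually_ge_atTop y

theorem exists_sub_mul_log_le {A : Type*} [CommRing A] (σ τ : A →+* ℝ)
    (hστ : ∀ x, σ x ≠ 0 → 1 ≤ |σ x| * |τ x|) (w w' D : A) (hw : w * w' = 1) {b : ℕ} (hb : 2 ≤ b)
    (hσw : 1 < σ w) (hτw : |τ w| ≤ 1) (hτw' : |τ w'| ≤ σ w)
    (hirr : Irrational (Real.log (σ w) / Real.log b)) (hσD : 0 < σ D) (hτD : |τ D| ≤ σ D)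
    {ε : ℝ} (hε : 0 < ε) :
    ∃ (c : ℝ) (N : ℕ), ∀ m d k e : ℕ, N ≤ m + d → 1 ≤ e → e ≤ b →
      ((b : ℝ) - 1) * (σ w ^ (m + d) - τ w ^ (m + d) - σ w ^ m + τ w ^ m) =
        e * σ D * (b ^ k - 1) →
      d * Real.log (σ w) ≤ ε * (m + d : ℕ) + c := by
  obtain ⟨δ, hδ, n₁, h⟩ := exists_forall_exp_neg_le_of_abs_sub_le σ τ hστ w w' hw hb hσw
    (hτw.trans hσw.le) hτw' hirr hε
  obtain ⟨N, hN⟩ := Filter.eventually_atTop.1 ((Filter.eventually_ge_atTop n₁).and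
    ((eventually_le_exp_mul hδ (b : ℝ)).and (eventually_le_exp_mul hδ (b * σ D))))
  have hb' : (2 : ℝ) ≤ b := by exact_mod_cast hb
  set c : ℝ := 3 * b + b * σ D with hc
  have hc0 : 0 < c := by positivity
  refine ⟨Real.log (2 * c), N, fun m d k e hmd he heb heq => ?_⟩
  obtain ⟨h1, h2, h3⟩ := hN _ hmd
  have he' : (1 : ℝ) ≤ e := by exact_mod_cast he
  have heb' : (e : ℝ) ≤ b := by exact_mod_cast heb
  have hw0 : 0 < σ w := by linarith
  have hpow : ∀ i : ℕ, |τ w ^ i| ≤ 1 := fun i => by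
    rw [abs_pow]; exact pow_le_one₀ (abs_nonneg _) hτw
  have hσb : σ ((b : A) - 1) = b - 1 := by simp
  have hτb : τ ((b : A) - 1) = b - 1 := by simp
  have hσe : σ ((e : A) * D) = e * σ D := by simp
  have hτe : |τ ((e : A) * D)| = e * |τ D| := by simp [abs_mul]
  have hαd : (0 : ℝ) < σ w ^ d := by positivity
  have hαm : (1 : ℝ) ≤ σ w ^ m := one_le_pow₀ hσw.le
  have hlogd : d * Real.log (σ w) = Real.log (σ w ^ d) := by rw [Real.log_pow]
  rw [hlogd]
  have key := h (m + d) h1 k (b - 1) (e * D) (by rw [hσb]; linarith) (by rw [hσe]; positivity)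
    (by rw [hσb]; linarith) (by rw [hσe]; exact le_trans (by gcongr) h3)
    (by rw [hτb, abs_of_nonneg (by linarith)]; linarith)
    (by rw [hτe]; exact le_trans (by gcongr) h3) (c / σ w ^ d)
  rcases le_or_gt (c / σ w ^ d) (1 / 2) with ht | ht
  · have h4 := key ht (by
      rw [hσb, hσe]
      have e1 : ((b : ℝ) - 1) * σ w ^ (m + d) - e * σ D * b ^ k =
          (b - 1) * (σ w ^ m + τ w ^ (m + d) - τ w ^ m) - e * σ D := by linarith
      have e2 : c / σ w ^ d * ((b - 1) * σ w ^ (m + d)) = c * σ w ^ m * (b - 1) := by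
        rw [pow_add]; field_simp
      have e3 : c * σ w ^ m ≤ c * σ w ^ m * (b - 1) :=
        le_mul_of_one_le_right (by positivity) (by linarith)
      rw [e1, e2]
      refine le_trans ?_ e3
      have e4 : |σ w ^ m + τ w ^ (m + d) - τ w ^ m| ≤ 3 * σ w ^ m := by
        have p1 := abs_le.1 (hpow m)
        have p2 := abs_le.1 (hpow (m + d))
        rw [abs_le]
        constructor <;> linarith
      calc |((b : ℝ) - 1) * (σ w ^ m + τ w ^ (m + d) - τ w ^ m) - e * σ D|
          ≤ |((b : ℝ) - 1) * (σ w ^ m + τ w ^ (m + d) - τ w ^ m)| + |e * σ D| := abs_sub _ _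
        _ ≤ b * (3 * σ w ^ m) + b * σ D * σ w ^ m := by
            rw [abs_mul, abs_of_nonneg (by linarith : (0 : ℝ) ≤ b - 1),
              abs_of_nonneg (by positivity : 0 ≤ e * σ D)]
            refine add_le_add (mul_le_mul (by linarith) e4 (abs_nonneg _) (by positivity)) ?_
            calc e * σ D ≤ b * σ D := by gcongr
              _ ≤ _ := le_mul_of_one_le_right (by positivity) hαm
        _ = c * σ w ^ m := by rw [hc]; ring)
    have h5 := Real.log_le_log (Real.exp_pos _) h4
    rw [Real.log_exp, ← mul_div_assoc, Real.log_div (by positivity) hαd.ne'] at h5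
    linarith
  · rw [lt_div_iff₀ hαd] at ht
    have := Real.log_le_log hαd (by linarith : σ w ^ d ≤ 2 * c)
    have h6 : 0 ≤ ε * (m + d : ℕ) := by positivity
    linarith

theorem exists_forall_le_of_eq {A : Type*} [CommRing A] (σ τ : A →+* ℝ)
    (hστ : ∀ x, σ x ≠ 0 → 1 ≤ |σ x| * |τ x|) (w w' D : A) (hw : w * w' = 1) {b : ℕ} (hb : 2 ≤ b)
    (hσw : 1 < σ w) (hτw : |τ w| ≤ 1) (hτw' : |τ w'| ≤ σ w)
    (hirr : Irrational (Real.log (σ w) / Real.log b)) (hσD : 0 < σ D) (hτD : |τ D| ≤ σ D) :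
    ∃ B : ℕ, ∀ m d k e : ℕ, 1 ≤ d → 1 ≤ e → e ≤ b →
      ((b : ℝ) - 1) * (σ w ^ (m + d) - τ w ^ (m + d) - σ w ^ m + τ w ^ m) =
        e * σ D * (b ^ k - 1) → m + d ≤ B := by
  set a := Real.log (σ w) with ha_def
  have ha : 0 < a := Real.log_pos hσw
  have hb' : (2 : ℝ) ≤ b := by exact_mod_cast hb
  have hw0 : 0 < σ w := by linarith
  have hexp : ∀ i : ℕ, σ w ^ i = Real.exp (i * a) := fun i => by
    rw [Real.exp_nat_mul, ha_def, Real.exp_log hw0]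
  obtain ⟨δ, hδ, n₁, h⟩ := exists_forall_exp_neg_le_of_abs_sub_le σ τ hστ w w' hw hb hσw
    (hτw.trans hσw.le) hτw' hirr (half_pos ha)
  obtain ⟨c, N, hc⟩ := exists_sub_mul_log_le σ τ hστ w w' D hw hb hσw hτw hτw' hirr hσD hτD
    (lt_min (half_pos ha) (show 0 < δ / 4 by positivity))
  set C : ℝ := 2 * b + b * σ D with hC
  have hC0 : 0 < C := by positivity
  have hα1 : 0 < σ w - 1 := by linarith
  obtain ⟨M, hM⟩ := Filter.eventually_atTop.1 ((Filter.eventually_ge_atTop n₁).and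
    ((eventually_le_exp_mul (half_pos hδ) (b * Real.exp (2 * c))).and
    ((eventually_le_exp_mul hδ (b * σ D)).and ((eventually_le_exp_mul hδ (b * 2)).and
    (eventually_le_exp_mul (half_pos ha) (2 * C / (σ w - 1) + 1))))))
  refine ⟨max N (M + ⌈(δ / 2 * M + 2 * c) / a⌉₊), fun m d k e hd he heb heq => ?_⟩
  rcases le_or_gt (m + d) N with hmd | hmd
  · exact hmd.trans (le_max_left _ _)
  refine le_trans ?_ (le_max_right _ _)
  have hda : d * a ≤ δ / 2 * m + 2 * c := by
    have h1 := hc m d k e hmd.le he heb heq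
    have h2 : min (a / 2) (δ / 4) * d ≤ a / 2 * d := by gcongr; exact min_le_left _ _
    have h3 : min (a / 2) (δ / 4) * m ≤ δ / 4 * m := by gcongr; exact min_le_right _ _
    push_cast at h1
    linarith
  rcases lt_or_ge m M with hm | hm
  · have h1 : (d : ℝ) ≤ ⌈(δ / 2 * M + 2 * c) / a⌉₊ := by
      refine le_trans ?_ (Nat.le_ceil _)
      rw [le_div_iff₀ ha]
      have : (m : ℝ) ≤ M := by exact_mod_cast hm.le
      have : δ / 2 * m ≤ δ / 2 * M := by gcongr
      linarith
    exact add_le_add hm.le (by exact_mod_cast h1)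
  exfalso
  obtain ⟨h1, h2, h3, h4, h5⟩ := hM m hm
  have he' : (1 : ℝ) ≤ e := by exact_mod_cast he
  have heb' : (e : ℝ) ≤ b := by exact_mod_cast heb
  have hpow : ∀ i : ℕ, |τ w ^ i| ≤ 1 := fun i => by
    rw [abs_pow]; exact pow_le_one₀ (abs_nonneg _) hτw
  have hαd : σ w ≤ σ w ^ d := le_self_pow₀ hσw.le (by omega)
  have hαm : (0 : ℝ) < σ w ^ m := by positivity
  have hσx : σ (((b : A) - 1) * (w ^ d - 1)) = (b - 1) * (σ w ^ d - 1) := by simp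
  have hτx : τ (((b : A) - 1) * (w ^ d - 1)) = (b - 1) * (τ w ^ d - 1) := by simp
  have hσe : σ ((e : A) * D) = e * σ D := by simp
  have hτe : |τ ((e : A) * D)| = e * |τ D| := by simp [abs_mul]
  set t : ℝ := C / ((σ w - 1) * σ w ^ m) with ht
  have hexpm : Real.exp (a / 2 * m) * Real.exp (a / 2 * m) = σ w ^ m := by
    rw [← Real.exp_add, hexp]; congr 1; ring
  have hone : 1 ≤ Real.exp (a / 2 * m) := Real.one_le_exp (by positivity)
  have hdiv : 0 ≤ 2 * C / (σ w - 1) := by positivity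
  have h2t : 2 * t = 2 * C / (σ w - 1) / σ w ^ m := by
    rw [ht]; field_simp
  have hlt : 2 * t < Real.exp (-(a / 2 * m)) := by
    rw [h2t, Real.exp_neg, ← hexpm, div_lt_iff₀ (by positivity), inv_mul_cancel_left₀
      (Real.exp_pos _).ne']
    linarith
  have hhalf : t ≤ 1 / 2 := by
    have : Real.exp (-(a / 2 * m)) ≤ 1 := Real.exp_le_one_iff.2 (by
      have : 0 ≤ a / 2 * m := by positivity
      linarith)
    linarith
  refine absurd (h m h1 k ((b - 1) * (w ^ d - 1)) (e * D) ?_ ?_ ?_ ?_ ?_ ?_ t hhalf ?_)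
    (not_le.2 hlt)
  · rw [hσx]
    exact mul_pos (by linarith) (by linarith)
  · rw [hσe]; positivity
  · rw [hσx]
    calc ((b : ℝ) - 1) * (σ w ^ d - 1) ≤ b * σ w ^ d :=
          mul_le_mul (by linarith) (by linarith) (by linarith) (by linarith)
      _ = b * Real.exp (d * a) := by rw [hexp]
      _ ≤ b * Real.exp (δ / 2 * m + 2 * c) := by gcongr
      _ = b * Real.exp (2 * c) * Real.exp (δ / 2 * m) := by rw [Real.exp_add]; ring
      _ ≤ Real.exp (δ / 2 * m) * Real.exp (δ / 2 * m) := by gcongr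
      _ = Real.exp (δ * m) := by rw [← Real.exp_add]; congr 1; ring
  · rw [hσe]; exact le_trans (by gcongr) h3
  · rw [hτx, abs_mul, abs_of_nonneg (by linarith : (0 : ℝ) ≤ b - 1)]
    refine le_trans (mul_le_mul (by linarith) ?_ (abs_nonneg _) (by linarith)) h4
    have := abs_le.1 (hpow d)
    rw [abs_le]
    constructor <;> linarith
  · rw [hτe]; exact le_trans (by gcongr) h3
  · rw [hσx, hσe]
    have e1 : ((b : ℝ) - 1) * (σ w ^ d - 1) * σ w ^ m - e * σ D * b ^ k =
        (b - 1) * (τ w ^ (m + d) - τ w ^ m) - e * σ D := by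
      rw [pow_add (σ w)] at heq
      linarith
    have e2 : C ≤ t * ((b - 1) * (σ w ^ d - 1) * σ w ^ m) := by
      have p1 : (σ w - 1) ≤ (b - 1) * (σ w ^ d - 1) := by
        nlinarith
      calc C = t * ((σ w - 1) * σ w ^ m) := by rw [ht]; field_simp
        _ ≤ _ := by gcongr
    rw [e1]
    refine le_trans ?_ e2
    have e4 : |τ w ^ (m + d) - τ w ^ m| ≤ 2 := by
      have p1 := abs_le.1 (hpow m)
      have p2 := abs_le.1 (hpow (m + d))
      rw [abs_le]
      constructor <;> linarith
    calc |((b : ℝ) - 1) * (τ w ^ (m + d) - τ w ^ m) - e * σ D|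
        ≤ |((b : ℝ) - 1) * (τ w ^ (m + d) - τ w ^ m)| + |e * σ D| := abs_sub _ _
      _ ≤ b * 2 + b * σ D := by
          rw [abs_mul, abs_of_nonneg (by linarith : (0 : ℝ) ≤ b - 1),
            abs_of_nonneg (by positivity : 0 ≤ e * σ D)]
          exact add_le_add (mul_le_mul (by linarith) e4 (abs_nonneg _) (by positivity))
            (by gcongr)
      _ = C := by rw [hC]; ring

theorem eq_zero_of_add_mul_half_eq_zero {ρ : ℝ} (hρ : Irrational ρ) {r x y : ℤ}
    (h : (x : ℝ) + y * ((r + ρ) / 2) = 0) : x = 0 ∧ y = 0 := by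
  have hy : y = 0 := by
    by_contra hy
    have hy' : (y : ℝ) ≠ 0 := by exact_mod_cast hy
    refine hρ.ne_rat (-(2 * x / y) - r) ?_
    push_cast
    field_simp
    linarith
  subst hy
  simpa using h

theorem irrational_log_div_log {α β : ℝ} (hα : 1 < α) (hβ : |β| ≤ 1) {b : ℕ} (hb : 2 ≤ b)
    (h : ∀ i j : ℕ, α ^ i = (b : ℝ) ^ j → β ^ i = (b : ℝ) ^ j) :
    Irrational (Real.log α / Real.log b) := by
  have hla : 0 < Real.log α := Real.log_pos hα
  have hlb : 0 < Real.log b := Real.log_pos (by exact_mod_cast hb)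
  rintro ⟨q, hq⟩
  have hq0 : 0 < q := by
    have : (0 : ℝ) < q := by rw [hq]; positivity
    exact_mod_cast this
  obtain ⟨n, hn⟩ : ∃ n : ℕ, q.num = n := ⟨q.num.toNat, (Int.toNat_of_nonneg (by positivity)).symm⟩
  have hden : (0 : ℝ) < q.den := by exact_mod_cast q.den_pos
  have h1 : (q.den : ℝ) * Real.log α = n * Real.log b := by
    have h2 : (q : ℝ) = n / q.den := by
      rw [Rat.cast_def, hn]; simp
    rw [h2, div_eq_div_iff hden.ne' hlb.ne'] at hq
    linarith
  have h3 : α ^ q.den = (b : ℝ) ^ n := by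
    rw [← Real.log_pow, ← Real.log_pow] at h1
    exact Real.log_injOn_pos (Set.mem_Ioi.2 (by positivity)) (Set.mem_Ioi.2 (by positivity)) h1
  have h4 : 1 < α ^ q.den := one_lt_pow₀ hα q.den_nz
  have h5 : |β ^ q.den| ≤ 1 := by
    rw [abs_pow]; exact pow_le_one₀ (abs_nonneg _) hβ
  rw [h q.den n h3, ← h3] at h5
  linarith [le_abs_self (α ^ q.den)]

theorem exists_forall_index_le_of_eq (r s : ℤ) (hr : 1 ≤ r) (hs : s = -1 ∨ s = 1)
    (hΔ : (0 : ℤ) < r ^ 2 + 4 * s) (hΔns : ¬ IsSquare (r ^ 2 + 4 * s))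
    (U : ℕ → ℤ) (hU0 : U 0 = 0) (hU1 : U 1 = 1)
    (hUrec : ∀ n : ℕ, U (n + 2) = r * U (n + 1) + s * U n) (b : ℕ) (hb : 2 ≤ b) :
    ∃ B : ℕ, ∀ m d k e : ℕ, 1 ≤ d → 1 ≤ e → e ≤ b →
      (e : ℤ) * ((b : ℤ) ^ k - 1) = (U (m + d) - U m) * (b - 1) → m + d ≤ B := by
  set ρ : ℝ := √((r ^ 2 + 4 * s : ℤ) : ℝ) with hρ
  have hρsq : ρ * ρ = r ^ 2 + 4 * s := by
    rw [hρ, Real.mul_self_sqrt (by exact_mod_cast hΔ.le)]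
    push_cast; ring
  have hρirr : Irrational ρ := by
    rw [hρ, irrational_sqrt_intCast_iff]
    exact ⟨hΔns, hΔ.le⟩
  have hρ1 : 1 < ρ := by
    have h2 : 2 ≤ r ^ 2 + 4 * s := by
      by_contra! h
      have : r ^ 2 + 4 * s = 1 := by omega
      exact hΔns (this ▸ IsSquare.one)
    rw [hρ, Real.lt_sqrt zero_le_one]
    have : (2 : ℝ) ≤ (r ^ 2 + 4 * s : ℤ) := by exact_mod_cast h2
    linarith
  have hr' : (1 : ℝ) ≤ r := by exact_mod_cast hr
  have hss : s * s = 1 := by rcases hs with rfl | rfl <;> rfl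
  have hsabs : |(s : ℝ)| = 1 := by rcases hs with rfl | rfl <;> simp
  set α : ℝ := (r + ρ) / 2 with hα
  set β : ℝ := (r + -ρ) / 2 with hβ
  have hα1 : 1 < α := by rw [hα]; linarith
  have hαβ : α * β = -s := by rw [hα, hβ]; linarith
  have hαα : α * α = s + r * α := by rw [hα]; linarith
  have hββ : β * β = s + r * β := by rw [hβ]; linarith
  have hβ1 : |β| ≤ 1 := by
    have h1 : |α| * |β| = 1 := by rw [← abs_mul, hαβ, abs_neg, hsabs]
    rw [abs_of_pos (by linarith)] at h1
    nlinarith [abs_nonneg β]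
  let σ : QuadraticAlgebra ℤ s r →+* ℝ :=
    (QuadraticAlgebra.lift ⟨α, by simpa using hαα⟩ : QuadraticAlgebra ℤ s r →ₐ[ℤ] ℝ)
  let τ : QuadraticAlgebra ℤ s r →+* ℝ :=
    (QuadraticAlgebra.lift ⟨β, by simpa using hββ⟩ : QuadraticAlgebra ℤ s r →ₐ[ℤ] ℝ)
  have hσ : ∀ z, σ z = z.re + z.im * α := fun z => by simp [σ]
  have hτ : ∀ z, τ z = z.re + z.im * β := fun z => by simp [τ]
  have hσ0 : ∀ z, σ z = 0 → z = 0 := by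
    intro z hz
    rw [hσ, hα] at hz
    obtain ⟨h1, h2⟩ := eq_zero_of_add_mul_half_eq_zero hρirr hz
    ext <;> simp [h1, h2]
  have hτ0 : ∀ z, τ z = 0 → z = 0 := by
    intro z hz
    rw [hτ, hβ] at hz
    obtain ⟨h1, h2⟩ := eq_zero_of_add_mul_half_eq_zero hρirr.neg hz
    ext <;> simp [h1, h2]
  have hστ : ∀ z, σ z ≠ 0 → 1 ≤ |σ z| * |τ z| := by
    intro z hz
    have hz0 : τ z ≠ 0 := fun h => hz (by rw [hτ0 z h, map_zero])
    have h1 : σ z * τ z = (z.norm : ℤ) := by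
      rw [QuadraticAlgebra.norm_def, hσ, hτ]
      have : α + β = r := by rw [hα, hβ]; ring
      push_cast
      linear_combination (z.re : ℝ) * z.im * this + (z.im : ℝ) * z.im * hαβ
    rw [← abs_mul, h1]
    have h2 : z.norm ≠ 0 := fun h => mul_ne_zero hz hz0 (by rw [h1, h, Int.cast_zero])
    exact_mod_cast Int.one_le_abs h2
  let w : QuadraticAlgebra ℤ s r := ⟨0, 1⟩
  let w' : QuadraticAlgebra ℤ s r := ⟨-(s * r), s⟩
  have hσw : σ w = α := by rw [hσ]; simp [w]
  have hτw : τ w = β := by rw [hτ]; simp [w]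
  have hww : w * w' = 1 := by
    ext
    · simp [w, w', hss, QuadraticAlgebra.re_one]
    · simp [w, w', QuadraticAlgebra.im_one]; ring
  have hτw' : |τ w'| ≤ α := by
    have : τ w' = -(s * α) := by
      rw [hτ, hα, hβ]; simp only [w']; push_cast; ring
    rw [this, abs_neg, abs_mul, hsabs, one_mul, abs_of_pos (by linarith)]
  have hirr : Irrational (Real.log α / Real.log b) := by
    refine irrational_log_div_log hα1 hβ1 hb fun i j hij => ?_
    have h1 : w ^ i - (b : QuadraticAlgebra ℤ s r) ^ j = 0 :=
      hσ0 _ (by rw [map_sub, map_pow, map_pow, hσw, map_natCast, hij, sub_self])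
    have h2 := congrArg τ h1
    rw [map_sub, map_pow, map_pow, hτw, map_natCast, map_zero] at h2
    linarith
  have hσD : σ ⟨-r, 2⟩ = ρ := by rw [hσ, hα]; push_cast; ring
  have hτD : τ ⟨-r, 2⟩ = -ρ := by rw [hτ, hβ]; push_cast; ring
  obtain ⟨B, hB⟩ := exists_forall_le_of_eq σ τ hστ w w' ⟨-r, 2⟩ hww hb (by rwa [hσw])
    (by rwa [hτw]) (by rwa [hσw]) (by rwa [hσw]) (by rw [hσD]; linarith)
    (by rw [hσD, hτD, abs_neg, abs_of_pos (by linarith)])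
  have hbinet : ∀ n, ρ * U n = α ^ n - β ^ n := by
    intro n
    induction n using Nat.twoStepInduction with
    | zero => simp [hU0]
    | one => rw [hU1, hα, hβ]; push_cast; ring
    | more n h0 h1 =>
      rw [hUrec]
      push_cast
      linear_combination (r : ℝ) * h1 + (s : ℝ) * h0 - α ^ n * hαα + β ^ n * hββ
  refine ⟨B, fun m d k e hd he heb heq => hB m d k e hd he heb ?_⟩
  rw [hσw, hτw, hσD]
  have h1 : (e : ℝ) * ((b : ℝ) ^ k - 1) = (U (m + d) - U m) * (b - 1) := by exact_mod_cast heq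
  linear_combination (1 - (b : ℝ)) * (hbinet (m + d) - hbinet m) - ρ * h1

/-- For fixed `b ≥ 2`, the Diophantine equation
`a·(b^k − 1)/(b − 1) = U_n − U_m` has only finitely many solutions `(k, m, n, a)`. -/
theorem repdigit_diff_lucas_finite_solutions
    (r s : ℤ) (hr : 1 ≤ r) (hs : s = -1 ∨ s = 1)
    (hΔ : (0 : ℤ) < r ^ 2 + 4 * s) (hΔns : ¬ IsSquare (r ^ 2 + 4 * s))
    (U : ℕ → ℤ) (hU0 : U 0 = 0) (hU1 : U 1 = 1)
    (hUrec : ∀ n : ℕ, U (n + 2) = r * U (n + 1) + s * U n)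
    (b : ℤ) (hb : 2 ≤ b) :
    Set.Finite {q : ℕ × ℕ × ℕ × ℤ |
      1 ≤ q.1 ∧ 1 ≤ q.2.1 ∧ 1 ≤ q.2.2.1 ∧ q.2.1 < q.2.2.1 ∧
      1 ≤ q.2.2.2 ∧ q.2.2.2 ≤ b - 1 ∧
      q.2.2.2 * (b ^ q.1 - 1) = (U q.2.2.1 - U q.2.1) * (b - 1)} := by
  lift b to ℕ using by omega
  obtain ⟨B, hB⟩ := exists_forall_index_le_of_eq r s hr hs hΔ hΔns U hU0 hU1 hUrec b
    (by exact_mod_cast hb)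
  refine Set.Finite.of_finite_image (f := Prod.snd) (((Set.finite_Iic B).prod
    ((Set.finite_Iic B).prod (Set.finite_Icc (1 : ℤ) b))).subset ?_) ?_
  · rintro _ ⟨⟨k, m, n, e⟩, ⟨-, -, -, hmn, he, heb, heq⟩, rfl⟩
    dsimp only at hmn he heb heq
    lift e to ℕ using by omega
    obtain ⟨d, rfl⟩ := Nat.exists_eq_add_of_lt hmn
    have := hB m (d + 1) k e (by omega) (by omega) (by omega) heq
    simp only [Set.mem_prod, Set.mem_Iic, Set.mem_Icc]
    omega
  · rintro ⟨k, m, n, e⟩ ⟨-, -, -, -, he, -, heq⟩ ⟨k', m', n', e'⟩ ⟨-, -, -, -, -, -, heq'⟩ h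
    obtain ⟨rfl, rfl, rfl⟩ : m = m' ∧ n = n' ∧ e = e' := by simpa using h
    dsimp only at he heq heq'
    have h1 : (b : ℤ) ^ k = (b : ℤ) ^ k' := by
      have := mul_left_cancel₀ (by omega : e ≠ 0) (heq.trans heq'.symm)
      linarith
    have h2 : b ^ k = b ^ k' := by exact_mod_cast h1
    rw [Nat.pow_right_injective (by exact_mod_cast hb) h2]
end

section
/- The only repdigits in base 10 (numbers of the form a·(10^k − 1)/9 with integers k ≥ 1 and 1 ≤ a ≤ 9) that can be written as a difference P_n − P_m of two Pell numbers with n > m ≥ 1 are 1, 3, 4, 7, 11 and 99. -/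
/-- The Pell numbers as natural numbers. -/
def pell : ℕ → ℕ
  | 0 => 0
  | 1 => 1
  | n + 2 => 2 * pell (n + 1) + pell n

lemma pell_add_two (n : ℕ) : pell (n + 2) = 2 * pell (n + 1) + pell n := rfl

lemma pell_mono : Monotone pell := by
  refine monotone_nat_of_le_succ fun n => ?_
  cases n with
  | zero => decide
  | succ n => rw [pell_add_two]; omega

lemma eq_pell_of_recurrence {P : ℕ → ℤ} (hP0 : P 0 = 0) (hP1 : P 1 = 1)
    (hPrec : ∀ n : ℕ, P (n + 2) = 2 * P (n + 1) + P n) (n : ℕ) : P n = pell n := by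
  induction n using Nat.twoStepInduction with
  | zero => simp [hP0, pell]
  | one => simp [hP1, pell]
  | more n ih₀ ih₁ => rw [hPrec, ih₀, ih₁, pell_add_two]; push_cast; rfl

/-- A return of the Pell sequence modulo `M` to its initial values makes it periodic. -/
lemma pell_add_modEq {M T : ℕ} (h₀ : pell T ≡ 0 [MOD M]) (h₁ : pell (T + 1) ≡ 1 [MOD M])
    (n : ℕ) : pell (n + T) ≡ pell n [MOD M] := by
  induction n using Nat.twoStepInduction with
  | zero => simpa [pell] using h₀
  | one => simpa [pell, add_comm] using h₁
  | more n ih₀ ih₁ =>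
    rw [show n + 2 + T = n + T + 2 by ring, pell_add_two, pell_add_two,
      show n + T + 1 = n + 1 + T by ring]
    exact (ih₁.mul_left 2).add ih₀

lemma pell_mod_modEq {M T : ℕ} (h₀ : pell T ≡ 0 [MOD M]) (h₁ : pell (T + 1) ≡ 1 [MOD M])
    (n : ℕ) : pell (n % T) ≡ pell n [MOD M] :=
  Function.Periodic.map_mod_nat (f := fun n => pell n % M) (pell_add_modEq h₀ h₁) n

lemma mul_pow_mod_modEq {M T b c : ℕ} (h : c * b ^ T ≡ c [MOD M]) (n : ℕ) :
    c * b ^ (n % T) ≡ c * b ^ n [MOD M] := by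
  refine Function.Periodic.map_mod_nat (f := fun n => c * b ^ n % M) (fun n => ?_) n
  have := h.mul_right (b ^ n)
  rwa [mul_assoc, ← pow_add, add_comm T] at this

set_option synthInstance.maxSize 10000 in
/-- The sieve: the equation `9 (P_n - P_m) = a (10 ^ (j + 4) - 1)` is not solvable simultaneously
modulo `2827440 = 2 ^ 4 * 3 ^ 3 * 5 * 7 * 11 * 17` and modulo `73`. The redundant congruence
modulo `80` prunes the search before `j` is chosen. -/
lemma pell_sieve : ∀ n < 48, ∀ m < 48, ∀ a < 10, 1 ≤ a →
    (9 * pell n + a) % 80 = 9 * pell m % 80 →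
    ∀ j < 48, (9 * pell n + a) % 2827440 = (9 * pell m + a * (10 ^ 4 * 10 ^ j)) % 2827440 →
    ∀ u < 3, ∀ v < 3, (9 * pell (n + 48 * u) + a) % 73 ≠
      (9 * pell (m + 48 * v) + a * (10 ^ 4 * 10 ^ j)) % 73 := by
  decide +kernel

lemma pell_sub_ne_repdigit_of_four_le {n m a k : ℕ} (ha₁ : 1 ≤ a) (ha₉ : a ≤ 9) (hk : 4 ≤ k) :
    9 * pell n + a ≠ 9 * pell m + a * 10 ^ k := by
  obtain ⟨j, rfl⟩ := Nat.exists_eq_add_of_le hk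
  intro h
  rw [pow_add] at h
  have hpell (i : ℕ) : 9 * pell (i % 48) ≡ 9 * pell i [MOD 2827440] :=
    (pell_mod_modEq (M := 314160) (by decide +kernel) (by decide +kernel) i).mul_left' 9
  have hpow : 10 ^ 4 * 10 ^ (j % 48) ≡ 10 ^ 4 * 10 ^ j [MOD 2827440] :=
    mul_pow_mod_modEq (by decide +kernel) j
  have hmod : 9 * pell (n % 48) + a ≡ 9 * pell (m % 48) + a * (10 ^ 4 * 10 ^ (j % 48))
      [MOD 2827440] :=
    ((hpell n).add_right a).trans (h ▸ ((hpell m).add (hpow.mul_left a)).symm)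
  have hmod80 : 9 * pell (n % 48) + a ≡ 9 * pell (m % 48) [MOD 80] := by
    have h₀ : a * (10 ^ 4 * 10 ^ (j % 48)) ≡ 0 [MOD 80] :=
      Nat.modEq_zero_iff_dvd.2 (((by norm_num : 80 ∣ 10 ^ 4).mul_right _).mul_left _)
    exact (hmod.of_dvd (by norm_num)).trans (h₀.add_left _)
  have hsplit (i : ℕ) : i % 48 + 48 * (i % 144 / 48) = i % 144 := by omega
  have hpell73 (i : ℕ) : pell (i % 48 + 48 * (i % 144 / 48)) ≡ pell i [MOD 73] := by
    rw [hsplit]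
    exact pell_mod_modEq (by decide +kernel) (by decide +kernel) i
  have hpow73 : 10 ^ 4 * 10 ^ (j % 48) ≡ 10 ^ 4 * 10 ^ j [MOD 73] :=
    mul_pow_mod_modEq (by decide +kernel) j
  refine pell_sieve (n % 48) (by omega) (m % 48) (by omega) a (by omega) ha₁ hmod80
    (j % 48) (by omega) hmod (n % 144 / 48) (by omega) (m % 144 / 48) (by omega) ?_
  exact (((hpell73 n).mul_left 9).add_right a).trans
    (h ▸ (((hpell73 m).mul_left 9).add (hpow73.mul_left a)).symm)

lemma lt_ten_of_pell_lt {n m : ℕ} (hmn : m < n) (h : pell n < pell m + 1393) : n < 10 := by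
  by_contra! hn
  obtain ⟨i, rfl⟩ := Nat.exists_eq_add_of_le' (show 2 ≤ n by omega)
  have h₁ : pell m ≤ pell (i + 1) := pell_mono (by omega)
  have h₂ : pell 9 ≤ pell (i + 1) := pell_mono (by omega)
  have h₃ : pell 8 ≤ pell i := pell_mono (by omega)
  have h₈ : pell 8 = 408 := by decide
  have h₉ : pell 9 = 985 := by decide
  rw [pell_add_two] at h
  omega

set_option synthInstance.maxSize 10000 in
lemma pell_sub_repdigit_of_small : ∀ n < 10, ∀ m < n, 1 ≤ m → ∀ a < 10, ∀ k < 4,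
    9 * pell n + a = 9 * pell m + a * 10 ^ k →
      pell n - pell m ∈ [1, 3, 4, 7, 11, 99] := by
  decide +kernel

/-- The only base-10 repdigits that are a difference of two Pell numbers
(with `n > m ≥ 1`) are `1, 3, 4, 7, 11` and `99`. -/
theorem repdigits_as_pell_differences
    (P : ℕ → ℤ) (hP0 : P 0 = 0) (hP1 : P 1 = 1)
    (hPrec : ∀ n : ℕ, P (n + 2) = 2 * P (n + 1) + P n) :
    ∀ N : ℤ,
      ((∃ k : ℕ, ∃ a : ℤ, 1 ≤ k ∧ 1 ≤ a ∧ a ≤ 9 ∧ 9 * N = a * (10 ^ k - 1)) ∧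
        (∃ n m : ℕ, 1 ≤ m ∧ m < n ∧ N = P n - P m)) ↔
      N ∈ ({1, 3, 4, 7, 11, 99} : Set ℤ) := by
  have hP := eq_pell_of_recurrence hP0 hP1 hPrec
  intro N
  simp only [hP, Set.mem_insert_iff, Set.mem_singleton_iff]
  constructor
  · rintro ⟨⟨k, a, -, ha₁, ha₉, hN⟩, n, m, hm, hmn, rfl⟩
    lift a to ℕ using by omega
    have h : 9 * pell n + a = 9 * pell m + a * 10 ^ k := by
      zify
      linarith
    have hk : k < 4 := by
      by_contra! hk
      exact pell_sub_ne_repdigit_of_four_le (by omega) (by omega) hk h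
    have hpow : a * 10 ^ k ≤ 9 * 10 ^ 3 :=
      Nat.mul_le_mul (by omega) (Nat.pow_le_pow_right (by norm_num) (by omega))
    have hn : n < 10 := lt_ten_of_pell_lt hmn (by omega)
    have hmem := pell_sub_repdigit_of_small n hn m hmn hm a (by omega) k hk h
    have hle : pell m ≤ pell n := pell_mono hmn.le
    simp only [List.mem_cons, List.not_mem_nil, or_false] at hmem
    omega
  · rintro (rfl | rfl | rfl | rfl | rfl | rfl)
    · exact ⟨⟨1, 1, by norm_num⟩, 2, 1, by decide⟩
    · exact ⟨⟨1, 3, by norm_num⟩, 3, 2, by decide⟩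
    · exact ⟨⟨1, 4, by norm_num⟩, 3, 1, by decide⟩
    · exact ⟨⟨1, 7, by norm_num⟩, 4, 3, by decide⟩
    · exact ⟨⟨2, 1, by norm_num⟩, 4, 1, by decide⟩
    · exact ⟨⟨2, 9, by norm_num⟩, 7, 6, by decide⟩
end

section
/- Let r ≥ 1 be an integer and H > 0 a real number such that H > (4r²)^r and H > L/(log L)^r, where L is a real number with L > e. Then L < 2^r · H · (log H)^r. -/
/-- Any `y` at least `4 r log (2 r)` satisfies `2 r log y ≤ y`. -/
lemma two_mul_mul_log_le_of_four_mul_log_le {r y : ℝ} (hr : 1 ≤ r)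
    (hy : 4 * r * Real.log (2 * r) ≤ y) : 2 * r * Real.log y ≤ y := by
  have hr0 : 0 < r := by linarith
  have hlog : Real.log (2 * r) = Real.log 2 + Real.log r :=
    Real.log_mul (by norm_num) hr0.ne'
  have h2 := Real.log_two_gt_d9
  have h2' := Real.log_two_lt_d9
  have hlr := Real.log_nonneg hr
  have hlr' := Real.log_le_sub_one_of_pos hr0
  set a := 4 * r * Real.log (2 * r) with ha
  have ha2 : 2 * r ≤ a := by nlinarith
  have ha0 : 0 < a := by linarith
  have hy0 : 0 < y := by linarith
  have hloga : Real.log a ≤ 2 * Real.log (2 * r) := by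
    have h : a ≤ (2 * r) ^ 2 := by nlinarith
    simpa using Real.log_le_log ha0 h
  have htangent : Real.log y ≤ Real.log a + (y - a) / a := by
    have h := Real.log_le_sub_one_of_pos (div_pos hy0 ha0)
    rw [Real.log_div hy0.ne' ha0.ne'] at h
    rw [sub_div, div_self ha0.ne']
    linarith
  have hslope : 2 * r * ((y - a) / a) ≤ y - a := by
    rw [← mul_div_assoc, div_le_iff₀ ha0]
    nlinarith
  nlinarith

/-- The lemma of Gúzman, Sánchez and Luca. -/
theorem guzman_sanchez_luca
    (r : ℕ) (hr : 1 ≤ r) (H L : ℝ) (hH : 0 < H)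
    (hH1 : ((4 * r ^ 2 : ℕ) : ℝ) ^ r < H)
    (hL : Real.exp 1 < L)
    (hH2 : L / (Real.log L) ^ r < H) :
    L < 2 ^ r * H * (Real.log H) ^ r := by
  have hL0 : 0 < L := (Real.exp_pos 1).trans hL
  have hlogL : 1 < Real.log L := (Real.lt_log_iff_exp_lt hL0).2 hL
  have hpow : 0 < Real.log L ^ r := by positivity
  have hr1 : (1 : ℝ) ≤ r := by exact_mod_cast hr
  have hlogH : r * (2 * Real.log (2 * r)) < Real.log H := by
    have h := Real.log_lt_log (by positivity) hH1
    rw [Real.log_pow] at h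
    have h4 : ((4 * r ^ 2 : ℕ) : ℝ) = (2 * r) ^ 2 := by push_cast; ring
    rw [h4, Real.log_pow] at h
    exact_mod_cast h
  have hlog : Real.log L - r * Real.log (Real.log L) < Real.log H := by
    have h := Real.log_lt_log (by positivity) hH2
    rwa [Real.log_div hL0.ne' hpow.ne', Real.log_pow] at h
  have hlt : Real.log L < 2 * Real.log H := by
    by_contra! hle
    have := two_mul_mul_log_le_of_four_mul_log_le hr1 (y := Real.log L) (by linarith)
    linarith
  calc L < H * Real.log L ^ r := (div_lt_iff₀ hpow).1 hH2
    _ ≤ H * (2 * Real.log H) ^ r := by gcongr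
    _ = 2 ^ r * H * Real.log H ^ r := by rw [mul_pow]; ring
end

section
/- Let τ be an irrational real number and μ, A, B real numbers with A > 0 and B > 1. Let M be a positive integer and let p/q be a convergent of the continued fraction expansion of τ with q > 6M. Set ε := ‖μq‖ − M·‖τq‖, where ‖·‖ denotes the distance to the nearest integer. If ε > 0, then there is no solution of the inequality 0 < mτ − n + μ < A·B^{−k} in positive integers m, n, k with m ≤ M and k ≥ log(Aq/ε)/log B. -/
/-- The Baker–Davenport reduction lemma (Dujella–Pethő). Here
`|x - round x|` is the distance from `x` to the nearest integer. -/
theorem baker_davenport_reduction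
    (τ : ℝ) (hτ : Irrational τ) (μ A B : ℝ) (hA : 0 < A) (hB : 1 < B)
    (M : ℕ) (hM : 0 < M)
    (p : ℤ) (q : ℕ) (hq : 6 * M < q)
    (hconv : ∃ i : ℕ, (GenContFract.of τ).convs i = (p : ℝ) / (q : ℝ))
    (ε : ℝ)
    (hε : ε = |μ * q - round (μ * q)| - M * |τ * q - round (τ * q)|)
    (hεpos : 0 < ε) :
    ¬ ∃ m n k : ℕ, 0 < m ∧ 0 < n ∧ 0 < k ∧ (m : ℝ) ≤ M ∧
        Real.log (A * q / ε) / Real.log B ≤ (k : ℝ) ∧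
        0 < (m : ℝ) * τ - n + μ ∧ (m : ℝ) * τ - n + μ < A * B ^ (-(k : ℤ)) := by
  rintro ⟨m, n, k, -, -, -, hmM, hk, hpos, hlt⟩
  have hq0 : (0 : ℝ) < q := by exact_mod_cast (by omega : 0 < q)
  have hlogB : 0 < Real.log B := Real.log_pos hB
  have hBk : 0 < B ^ k := pow_pos (by linarith) k
  have hlower : ε ≤ q * (m * τ - n + μ) := by
    have hround := round_le (μ * q) ((n : ℤ) * q - m * round (τ * q))
    push_cast at hround
    have hsplit : μ * q - (n * q - m * round (τ * q)) =
        q * (m * τ - n + μ) - m * (τ * q - round (τ * q)) := by ring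
    have htri := abs_sub (q * (m * τ - n + μ)) (m * (τ * q - round (τ * q)))
    rw [abs_of_pos (mul_pos hq0 hpos), abs_mul, Nat.abs_cast] at htri
    have hmul := mul_le_mul_of_nonneg_right hmM (abs_nonneg (τ * q - round (τ * q)))
    rw [hsplit] at hround
    linarith
  have hupper : A * q / ε ≤ B ^ k := by
    rw [div_le_iff₀ hlogB, ← Real.log_pow] at hk
    exact (Real.log_le_log_iff (by positivity) hBk).mp hk
  rw [zpow_neg, zpow_natCast, ← div_eq_mul_inv, lt_div_iff₀ hBk] at hlt
  rw [div_le_iff₀ hεpos] at hupper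
  have hscaled := mul_lt_mul_of_pos_left hlt hq0
  have hlowerk := mul_le_mul_of_nonneg_right hlower hBk.le
  linarith
end

section
/- Let r ≥ 1 and s ∈ {-1, 1} be integers with Δ := r² + 4s > 0, and let (U_n)_{n≥0} be the generalized Lucas sequence with U_0 = 0, U_1 = 1, U_{n+1} = r·U_n + s·U_{n-1}; set δ := (r + √Δ)/2 and γ := (r − √Δ)/2. Let b ≥ 2 be an integer and let k, m, n be positive integers and a an integer with 1 ≤ a ≤ b−1 satisfying a·(b^k − 1)/(b − 1) = U_n − U_m with n > m. Then |δ^n/(δ − γ) − a·b^k/(b − 1)| < ((1 + 3√Δ)/√Δ)·δ^m. -/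
/-- Binet's formula, cleared of its denominator, for a sequence with `U 0 = 0` and `U 1 = 1`
satisfying a binary recurrence whose characteristic roots are `δ` and `γ`. -/
theorem lucas_binet {r s : ℤ} {U : ℕ → ℤ} (hU0 : U 0 = 0) (hU1 : U 1 = 1)
    (hUrec : ∀ n : ℕ, U (n + 2) = r * U (n + 1) + s * U n)
    {δ γ : ℝ} (hδ : δ ^ 2 = r * δ + s) (hγ : γ ^ 2 = r * γ + s) (n : ℕ) :
    (U n : ℝ) * (δ - γ) = δ ^ n - γ ^ n := by
  induction n using Nat.twoStepInduction with
  | zero => simp [hU0]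
  | one => simp [hU1]
  | more n ih₀ ih₁ =>
    rw [hUrec]
    push_cast
    linear_combination (r : ℝ) * ih₁ + (s : ℝ) * ih₀ - δ ^ n * hδ + γ ^ n * hγ

/-- `|δ^n/(δ − γ) − a·b^k/(b − 1)| < ((1 + 3√Δ)/√Δ)·δ^m`. -/
theorem repdigit_diff_lucas_first_estimate
    (r s : ℤ) (hr : 1 ≤ r) (hs : s = -1 ∨ s = 1)
    (hΔ : (0 : ℤ) < r ^ 2 + 4 * s)
    (U : ℕ → ℤ) (hU0 : U 0 = 0) (hU1 : U 1 = 1)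
    (hUrec : ∀ n : ℕ, U (n + 2) = r * U (n + 1) + s * U n)
    (δ γ : ℝ)
    (hδ : δ = ((r : ℝ) + Real.sqrt ((r : ℝ) ^ 2 + 4 * (s : ℝ))) / 2)
    (hγ : γ = ((r : ℝ) - Real.sqrt ((r : ℝ) ^ 2 + 4 * (s : ℝ))) / 2)
    (b : ℤ) (hb : 2 ≤ b)
    (k m n : ℕ) (hk : 1 ≤ k) (hm : 1 ≤ m) (hn : 1 ≤ n) (hnm : m < n)
    (a : ℤ) (ha1 : 1 ≤ a) (ha2 : a ≤ b - 1)
    (heq : a * (b ^ k - 1) = (U n - U m) * (b - 1)) :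
    |δ ^ n / (δ - γ) - (a : ℝ) * (b : ℝ) ^ k / ((b : ℝ) - 1)| <
      (1 + 3 * Real.sqrt ((r : ℝ) ^ 2 + 4 * s)) /
        Real.sqrt ((r : ℝ) ^ 2 + 4 * s) * δ ^ m := by
  have hΔ5 : (5 : ℤ) ≤ r ^ 2 + 4 * s := by
    rcases hs with rfl | rfl
    · have hr3 : 3 ≤ r := by
        by_contra! h
        interval_cases r <;> norm_num at hΔ
      nlinarith
    · nlinarith
  have hΔ5' : (5 : ℝ) ≤ (r : ℝ) ^ 2 + 4 * (s : ℝ) := by exact_mod_cast hΔ5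
  have hr' : (1 : ℝ) ≤ r := by exact_mod_cast hr
  have hb' : (1 : ℝ) ≤ (b : ℝ) - 1 := by
    have : (2 : ℝ) ≤ b := by exact_mod_cast hb
    linarith
  have hDsq : Real.sqrt ((r : ℝ) ^ 2 + 4 * s) ^ 2 = (r : ℝ) ^ 2 + 4 * s :=
    Real.sq_sqrt (by linarith)
  have hD2 : 2 < Real.sqrt ((r : ℝ) ^ 2 + 4 * s) :=
    Real.lt_sqrt_of_sq_lt (by linarith)
  generalize Real.sqrt ((r : ℝ) ^ 2 + 4 * s) = D at *
  have hD0 : 0 < D := by linarith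
  have hsub : δ - γ = D := by rw [hδ, hγ]; ring
  have hδ1 : 1 ≤ δ := by rw [hδ]; linarith
  have hbinet := lucas_binet (δ := δ) (γ := γ) hU0 hU1 hUrec
    (by rw [hδ]; linear_combination hDsq / 4) (by rw [hγ]; linear_combination hDsq / 4)
  have hγ1 : |γ| ≤ 1 := by
    have hprod : |δ| * |γ| = 1 := by
      rw [← abs_mul, show δ * γ = -(s : ℝ) by rw [hδ, hγ]; linear_combination -hDsq / 4]
      rcases hs with rfl | rfl <;> simp
    rw [abs_of_nonneg (by linarith : (0 : ℝ) ≤ δ)] at hprod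
    nlinarith [abs_nonneg γ]
  have hγpow (j : ℕ) : |γ ^ j| ≤ 1 := by
    rw [abs_pow]
    exact pow_le_one₀ (abs_nonneg γ) hγ1
  have hδm : 1 ≤ δ ^ m := one_le_pow₀ hδ1
  have hq0 : 0 ≤ (a : ℝ) / (b - 1) := by
    have : (1 : ℝ) ≤ a := by exact_mod_cast ha1
    positivity
  have hq1 : (a : ℝ) / (b - 1) ≤ 1 := by
    rw [div_le_one (by linarith)]
    exact_mod_cast ha2
  have heq' : (a : ℝ) * ((b : ℝ) ^ k - 1) = ((U n : ℝ) - U m) * (b - 1) := by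
    exact_mod_cast heq
  have hrep : (a : ℝ) * (b : ℝ) ^ k / (b - 1) = (U n : ℝ) - U m + a / (b - 1) := by
    have : (b : ℝ) - 1 ≠ 0 := by linarith
    field_simp
    linear_combination heq'
  have hUn : (U n : ℝ) = (δ ^ n - γ ^ n) / D := by
    rw [eq_div_iff hD0.ne', ← hsub, hbinet]
  have hUm : (U m : ℝ) = (δ ^ m - γ ^ m) / D := by
    rw [eq_div_iff hD0.ne', ← hsub, hbinet]
  have hdiff : δ ^ n / (δ - γ) - (a : ℝ) * (b : ℝ) ^ k / (b - 1) =
      (δ ^ m + (γ ^ n - γ ^ m)) / D - a / (b - 1) := by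
    rw [hrep, hUn, hUm, hsub]
    ring
  have hbound : (1 + 3 * D) / D * δ ^ m = δ ^ m / D + 3 * δ ^ m := by
    field_simp
  have hsmall : |(γ ^ n - γ ^ m) / D| ≤ 1 := by
    rw [abs_div, abs_of_pos hD0, div_le_one hD0]
    linarith [abs_sub (γ ^ n) (γ ^ m), hγpow n, hγpow m]
  have hmain : 0 < δ ^ m / D := by positivity
  rw [hdiff, hbound, add_div, abs_lt]
  obtain ⟨hlo, hhi⟩ := abs_le.mp hsmall
  constructor <;> linarith
end

section
/- Let r ≥ 1 and s ∈ {-1, 1} be integers with Δ := r² + 4s > 0 and Δ not a perfect square; set δ := (r + √Δ)/2. Let b ≥ 2 and 1 ≤ a ≤ b − 1 be integers and let k, n be positive integers. Then δ^n ≠ b^k·(a√Δ)/(b − 1); equivalently, the quantity 1 − δ^{−n}·b^k·(a√Δ)/(b − 1) is nonzero. -/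
/-- For `r > 0` and `D ≥ 0`, the powers of `r + √D` have the form `x + y√D` with integers `x > 0`
and `y ≥ 0`. -/
lemma exists_pow_add_sqrt_eq {r D : ℤ} (hr : 0 < r) (hD : 0 ≤ D) (n : ℕ) :
    ∃ x y : ℤ, 0 < x ∧ 0 ≤ y ∧
      ((r : ℝ) + Real.sqrt (D : ℝ)) ^ n = (x : ℝ) + (y : ℝ) * Real.sqrt (D : ℝ) := by
  induction n with
  | zero => exact ⟨1, 0, one_pos, le_rfl, by simp⟩
  | succ n ih =>
    obtain ⟨x, y, hx, hy, h⟩ := ih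
    refine ⟨r * x + D * y, x + r * y, by positivity, by positivity, ?_⟩
    have hsq : Real.sqrt (D : ℝ) ^ 2 = (D : ℝ) := Real.sq_sqrt (by exact_mod_cast hD)
    rw [pow_succ, h]
    push_cast
    linear_combination (y : ℝ) * hsq

/-- If `D` is not a square, no power of `r + √D` with `r > 0` is a rational multiple of `√D`. -/
lemma pow_add_sqrt_ne_ratCast_mul_sqrt {r D : ℤ} (hr : 0 < r) (hD : 0 ≤ D) (hns : ¬ IsSquare D)
    (n : ℕ) (q : ℚ) :
    ((r : ℝ) + Real.sqrt (D : ℝ)) ^ n ≠ (q : ℝ) * Real.sqrt (D : ℝ) := by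
  intro h
  obtain ⟨x, y, hx, -, hxy⟩ := exists_pow_add_sqrt_eq hr hD n
  have hirr : Irrational (Real.sqrt (D : ℝ)) := irrational_sqrt_intCast_iff.2 ⟨hns, hD⟩
  have heq : (x : ℝ) = ((q - y : ℚ) : ℝ) * Real.sqrt (D : ℝ) := by
    push_cast
    linear_combination h - hxy
  have hq : q - y ≠ 0 := by
    intro hq
    rw [hq, Rat.cast_zero, zero_mul] at heq
    exact hx.ne' (by exact_mod_cast heq)
  exact (hirr.ratCast_mul hq).ne_int x heq.symm


/-- Nonvanishing of the linear form: `δ^n ≠ b^k·(a√Δ)/(b − 1)`,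
equivalently `1 − δ^{−n}·b^k·(a√Δ)/(b − 1) ≠ 0`. -/
theorem linear_form_nonvanishing
    (r s : ℤ) (hr : 1 ≤ r) (hs : s = -1 ∨ s = 1)
    (hΔ : (0 : ℤ) < r ^ 2 + 4 * s) (hΔns : ¬ IsSquare (r ^ 2 + 4 * s))
    (δ : ℝ) (hδ : δ = ((r : ℝ) + Real.sqrt ((r : ℝ) ^ 2 + 4 * (s : ℝ))) / 2)
    (b : ℤ) (hb : 2 ≤ b)
    (a : ℤ) (ha1 : 1 ≤ a) (ha2 : a ≤ b - 1)
    (k n : ℕ) (hk : 1 ≤ k) (hn : 1 ≤ n) :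
    δ ^ n ≠ (b : ℝ) ^ k * ((a : ℝ) * Real.sqrt ((r : ℝ) ^ 2 + 4 * s) / ((b : ℝ) - 1)) ∧
    1 - δ ^ (-(n : ℤ)) * (b : ℝ) ^ k *
        ((a : ℝ) * Real.sqrt ((r : ℝ) ^ 2 + 4 * s) / ((b : ℝ) - 1)) ≠ 0 := by
  have hcast : (r : ℝ) ^ 2 + 4 * (s : ℝ) = ((r ^ 2 + 4 * s : ℤ) : ℝ) := by push_cast; ring
  rw [hcast] at hδ ⊢
  have hr0 : (0 : ℝ) < r := by exact_mod_cast hr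
  have hδ0 : 0 < δ := by rw [hδ]; positivity
  have hne : δ ^ n ≠ (b : ℝ) ^ k *
      ((a : ℝ) * Real.sqrt ((r ^ 2 + 4 * s : ℤ) : ℝ) / ((b : ℝ) - 1)) := by
    intro h
    refine pow_add_sqrt_ne_ratCast_mul_sqrt (r := r) (by omega) hΔ.le hΔns n
      (2 ^ n * (b ^ k * (a / (b - 1)))) ?_
    rw [show (r : ℝ) + Real.sqrt ((r ^ 2 + 4 * s : ℤ) : ℝ) = 2 * δ by rw [hδ]; ring, mul_pow, h]
    push_cast
    ring
  refine ⟨hne, fun h => hne ?_⟩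
  rw [zpow_neg, zpow_natCast, mul_assoc, sub_eq_zero] at h
  simpa using (eq_inv_mul_iff_mul_eq₀ (pow_pos hδ0 n).ne').1 h
end
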